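/- Let p̃ ∈ M̃ with t-coordinate t(p̃) ≤ 0, and suppose the cut locus C_p̃ contains a point with negative t-coordinate. Then there exist a cut point y of p̃ and two distinct minimal geodesic segments α and β joining p̃ to y such that the sector D(α, β) at y bounded by α and β contains an end point of C_p̃ and D(α, β) ⊂ {(t, θ) : t < 0}. -/

import Mathlib

open Real Set

noncomputable section

/-- Length of a C¹ curve `c` on `[a,b]` in the warped product metric
`ds² = dt² + m(t)² dθ²` on `M̃ = ℝ²` (coordinates `(t,θ)`). -/
def wLength (m : ℝ → ℝ) (c : ℝ → ℝ × ℝ) (a b : ℝ) : ℝ :=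
  ∫ s in a..b,
    Real.sqrt ((deriv (fun u => (c u).1) s) ^ 2 +
      (m (c s).1) ^ 2 * (deriv (fun u => (c u).2) s) ^ 2)

/-- The Riemannian distance on `M̃`: the infimum of lengths of C¹ curves joining `p` to `q`. -/
def wDist (m : ℝ → ℝ) (p q : ℝ × ℝ) : ℝ :=
  sInf {L : ℝ | ∃ c : ℝ → ℝ × ℝ, ∃ b : ℝ, 0 ≤ b ∧ ContDiff ℝ 1 c ∧
    c 0 = p ∧ c b = q ∧ L = wLength m c 0 b}

/-- `γ = (t(s), θ(s))` is a unit-speed geodesic of the warped product metric: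
`t'' = m(t) m'(t) θ'²`, `m(t)² θ'` is constant, and `t'² + m(t)² θ'² = 1`. -/
def IsUnitGeodesic (m : ℝ → ℝ) (γ : ℝ → ℝ × ℝ) : Prop :=
  ContDiff ℝ 2 γ ∧
  (∀ s, deriv (deriv fun u => (γ u).1) s =
      m (γ s).1 * deriv m (γ s).1 * (deriv (fun u => (γ u).2) s) ^ 2) ∧
  (∃ ν : ℝ, ∀ s, m (γ s).1 ^ 2 * deriv (fun u => (γ u).2) s = ν) ∧
  (∀ s, (deriv (fun u => (γ u).1) s) ^ 2 +
      m (γ s).1 ^ 2 * (deriv (fun u => (γ u).2) s) ^ 2 = 1)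

/-- `ν` is the Clairaut constant of the geodesic `γ`: `m(t(s))² θ'(s) = ν` for all `s`. -/
def HasClairaut (m : ℝ → ℝ) (γ : ℝ → ℝ × ℝ) (ν : ℝ) : Prop :=
  ∀ s, m (γ s).1 ^ 2 * deriv (fun u => (γ u).2) s = ν

/-- The (unit-speed) geodesic segment `γ|[0,a]` is minimal: its length `a` equals
the distance between its endpoints. -/
def IsMinimalSeg (m : ℝ → ℝ) (γ : ℝ → ℝ × ℝ) (a : ℝ) : Prop :=
  wDist m (γ 0) (γ a) = a

/-- `x` is a cut point of `p`: the endpoint of some minimal geodesic segment from `p`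
no extension of which is minimal. -/
def IsCutPoint (m : ℝ → ℝ) (p x : ℝ × ℝ) : Prop :=
  ∃ γ : ℝ → ℝ × ℝ, ∃ a : ℝ, IsUnitGeodesic m γ ∧ γ 0 = p ∧ 0 < a ∧ γ a = x ∧
    IsMinimalSeg m γ a ∧ ∀ ε > 0, ¬ IsMinimalSeg m γ (a + ε)

/-- The cut locus of `p` in `M̃`. -/
def cutLocus (m : ℝ → ℝ) (p : ℝ × ℝ) : Set (ℝ × ℝ) := {x | IsCutPoint m p x}

/-- The Gaussian curvature `K(t) = -m''(t)/m(t)` of the warped product metric. -/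
def gaussK (m : ℝ → ℝ) (t : ℝ) : ℝ := -(deriv (deriv m) t) / m t

/-- `ξ(ν) := min {t > 0 | m t = ν}`. -/
def xi (m : ℝ → ℝ) (ν : ℝ) : ℝ := sInf {t : ℝ | 0 < t ∧ m t = ν}

/-- `φ(ν) := 2∫₀^{ξ(ν)} ν / (m(t) √(m(t)² - ν²)) dt`. -/
def phi (m : ℝ → ℝ) (ν : ℝ) : ℝ :=
  2 * ∫ t in (0:ℝ)..(xi m ν), ν / (m t * Real.sqrt ((m t) ^ 2 - ν ^ 2))

/-- `l(ν) := 2∫_{-ξ(ν)}^{0} m(t) / √(m(t)² - ν²) dt`. -/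
def ell (m : ℝ → ℝ) (ν : ℝ) : ℝ :=
  2 * ∫ t in (-(xi m ν))..(0:ℝ), m t / Real.sqrt ((m t) ^ 2 - ν ^ 2)

/-- `inf m`. -/
def infm (m : ℝ → ℝ) : ℝ := ⨅ t : ℝ, m t

/-- `t₀ := sup {t > 0 | m'(t) < 0}`. -/
def tZero (m : ℝ → ℝ) : ℝ := sSup {t : ℝ | 0 < t ∧ deriv m t < 0}

/-- `Γ_x`: the set of all points lying on some minimal geodesic segment joining `p` to `x`. -/
def SegPoints (m : ℝ → ℝ) (p x : ℝ × ℝ) : Set (ℝ × ℝ) :=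
  {z | ∃ γ : ℝ → ℝ × ℝ, ∃ a : ℝ, IsUnitGeodesic m γ ∧ γ 0 = p ∧ 0 < a ∧ γ a = x ∧
    IsMinimalSeg m γ a ∧ ∃ s ∈ Set.Icc (0:ℝ) a, γ s = z}

/-- A sector at the cut point `x` of `p`: a connected component of `M̃ \ Γ_x`. -/
def IsSector (m : ℝ → ℝ) (p x : ℝ × ℝ) (D : Set (ℝ × ℝ)) : Prop :=
  ∃ z ∈ (SegPoints m p x)ᶜ, D = connectedComponentIn (SegPoints m p x)ᶜ z

/-- `x` is an end point of the cut locus of `p`: a cut point admitting exactly one sector. -/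
def IsEndPoint (m : ℝ → ℝ) (p x : ℝ × ℝ) : Prop :=
  IsCutPoint m p x ∧ ∃! D : Set (ℝ × ℝ), IsSector m p x D

/-- `D` is a sector bounded by the two geodesic segments `α|[0,Lα]` and `β|[0,Lβ]`:
a connected component of the complement of their union. -/
def IsSectorOf (α β : ℝ → ℝ × ℝ) (Lα Lβ : ℝ) (D : Set (ℝ × ℝ)) : Prop :=
  ∃ z ∈ (α '' Set.Icc 0 Lα ∪ β '' Set.Icc 0 Lβ)ᶜ,
    D = connectedComponentIn (α '' Set.Icc 0 Lα ∪ β '' Set.Icc 0 Lβ)ᶜ z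

/-- `γ s₁` is conjugate to `γ 0` along the geodesic `γ`: there is a nontrivial solution `J`
of the Jacobi equation `J'' + K(t(s)) J = 0` with `J 0 = J s₁ = 0`. -/
def ConjugateAlong (m : ℝ → ℝ) (γ : ℝ → ℝ × ℝ) (s₁ : ℝ) : Prop :=
  ∃ J : ℝ → ℝ, ContDiff ℝ 2 J ∧
    (∀ s, deriv (deriv J) s + gaussK m (γ s).1 * J s = 0) ∧
    J 0 = 0 ∧ J s₁ = 0 ∧ J ≠ 0

namespace CutAux
open MeasureTheory

/-- `√(1 - n²/m(x)²)`. -/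
def gg (m : ℝ → ℝ) (n x : ℝ) : ℝ := Real.sqrt (1 - n ^ 2 / m x ^ 2)

/-- Antiderivative of `gg`. -/
def GG (m : ℝ → ℝ) (n x : ℝ) : ℝ := ∫ y in (0:ℝ)..x, gg m n y

/-- `u / (m √(m² - u²))`, which is zero when `m ≤ u`. -/
def th (m : ℝ → ℝ) (u x : ℝ) : ℝ := u / (m x * Real.sqrt (m x ^ 2 - u ^ 2))

/-- The angle integral. -/
def Th (m : ℝ → ℝ) (u : ℝ) (S : Set ℝ) : ENNReal := ∫⁻ x in S, ENNReal.ofReal (th m u x)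

lemma gg_nonneg (m : ℝ → ℝ) (n x : ℝ) : 0 ≤ gg m n x := Real.sqrt_nonneg _

lemma gg_cont {m : ℝ → ℝ} (hc : Continuous m) (hpos : ∀ t, 0 < m t) (n : ℝ) :
    Continuous (gg m n) := by
  unfold gg
  have : ∀ x, m x ^ 2 ≠ 0 := fun x => pow_ne_zero _ (hpos x).ne'
  fun_prop (disch := assumption)

lemma GG_deriv {m : ℝ → ℝ} (hc : Continuous m) (hpos : ∀ t, 0 < m t) (n x : ℝ) :
    HasDerivAt (GG m n) (gg m n x) x := by
  have h := gg_cont hc hpos n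
  exact intervalIntegral.integral_hasDerivAt_right (h.intervalIntegrable _ _)
    h.stronglyMeasurable.stronglyMeasurableAtFilter h.continuousAt

lemma GG_mono {m : ℝ → ℝ} (hc : Continuous m) (hpos : ∀ t, 0 < m t) (n : ℝ) :
    Monotone (GG m n) :=
  monotone_of_deriv_nonneg (fun x => (GG_deriv hc hpos n x).differentiableAt)
    (fun x => by rw [(GG_deriv hc hpos n x).deriv]; exact gg_nonneg _ _ _)

lemma GG_zero (m : ℝ → ℝ) (n : ℝ) : GG m n 0 = 0 := by simp [GG]

lemma GG_neg {m : ℝ → ℝ} (hev : ∀ t, m (-t) = m t) (n x : ℝ) :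
    GG m n (-x) = - GG m n x := by
  unfold GG
  have h := intervalIntegral.integral_comp_neg (a := 0) (b := x) (fun y => gg m n y)
  have h2 : ∀ y, gg m n (-y) = gg m n y := fun y => by simp [gg, hev]
  simp only [h2, neg_zero] at h
  rw [h, intervalIntegral.integral_symm]

lemma GG_abs {m : ℝ → ℝ} (hc : Continuous m) (hpos : ∀ t, 0 < m t)
    (hev : ∀ t, m (-t) = m t) (n x : ℝ) : |GG m n x| = GG m n |x| := by
  rcases le_total 0 x with h | h
  · rw [abs_of_nonneg h, abs_of_nonneg]
    rw [← GG_zero m n]; exact GG_mono hc hpos n h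
  · rw [abs_of_nonpos h, GG_neg hev, abs_of_nonpos]
    rw [← GG_zero m n]; exact GG_mono hc hpos n h

lemma GG_abs_sub {m : ℝ → ℝ} (hc : Continuous m) (hpos : ∀ t, 0 < m t)
    (hev : ∀ t, m (-t) = m t) (n x y : ℝ) :
    |GG m n (|x|) - GG m n (|y|)| ≤ |GG m n x - GG m n y| := by
  rw [← GG_abs hc hpos hev, ← GG_abs hc hpos hev]
  exact abs_abs_sub_abs_le_abs_sub _ _

lemma GG_sub_lintegral {m : ℝ → ℝ} (hc : Continuous m) (hpos : ∀ t, 0 < m t) (n x y : ℝ) :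
    ENNReal.ofReal |GG m n x - GG m n y| = ∫⁻ z in uIoo x y, ENNReal.ofReal (gg m n z) := by
  wlog h : x ≤ y generalizing x y
  · rw [abs_sub_comm, uIoo_comm]
    exact this y x (not_le.1 h).le
  have h1 : |GG m n x - GG m n y| = ∫ z in x..y, gg m n z := by
    rw [intervalIntegral.integral_eq_sub_of_hasDerivAt (f := GG m n)
      (fun z _ => GG_deriv hc hpos n z) ((gg_cont hc hpos n).intervalIntegrable _ _),
      abs_sub_comm, abs_of_nonneg]
    linarith [GG_mono hc hpos n h]
  rw [h1, uIoo_of_le h, intervalIntegral.integral_of_le h, ← integral_Ioc_eq_integral_Ioo.symm,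
    ofReal_integral_eq_lintegral_ofReal]
  · exact ((gg_cont hc hpos n).integrableOn_Icc).mono_set Ioo_subset_Icc_self
  · exact Filter.Eventually.of_forall (fun z => gg_nonneg _ _ _)

/-- pointwise FTC in the Clairaut parameter -/
lemma th_ftc {m : ℝ → ℝ} (hpos : ∀ t, 0 < m t) (x : ℝ) {n₁ n₂ : ℝ} (h1 : 0 ≤ n₁)
    (h12 : n₁ ≤ n₂) :
    ENNReal.ofReal (gg m n₁ x) =
      ENNReal.ofReal (gg m n₂ x) + ∫⁻ u in Ioo n₁ n₂, ENNReal.ofReal (th m u x) := by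
  have hm := hpos x
  have key : ∀ n₁ n₂ : ℝ, 0 ≤ n₁ → n₁ ≤ n₂ → n₂ ≤ m x →
    ENNReal.ofReal (gg m n₁ x) =
      ENNReal.ofReal (gg m n₂ x) + ∫⁻ u in Ioo n₁ n₂, ENNReal.ofReal (th m u x) := by
    intro n₁ n₂ h1 h12 h2
    have hd : ∀ u ∈ Ioo n₁ n₂, HasDerivAt (fun u => - gg m u x) (th m u x) u := by
      intro u hu
      have hu0 : 0 < u := lt_of_le_of_lt h1 hu.1
      have hum : u < m x := lt_of_lt_of_le hu.2 h2
      have hp : 0 < m x ^ 2 - u ^ 2 := by nlinarith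
      have hq : 1 - u ^ 2 / m x ^ 2 = (m x ^ 2 - u ^ 2) / m x ^ 2 := by field_simp
      have hp' : 0 < 1 - u ^ 2 / m x ^ 2 := by rw [hq]; positivity
      have := (((hasDerivAt_pow 2 u).div_const (m x ^ 2)).const_sub 1).sqrt hp'.ne'
      convert! this.neg using 1
      rw [hq, Real.sqrt_div hp.le, Real.sqrt_sq hm.le, th]
      have := Real.sqrt_pos.2 hp
      field_simp
      push_cast
      ring
    have hcont : ContinuousOn (fun u => - gg m u x) (Icc n₁ n₂) := by
      unfold gg; fun_prop
    have hth : ∀ u ∈ Ioo n₁ n₂, 0 ≤ th m u x := by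
      intro u hu
      have hu0 : 0 < u := lt_of_le_of_lt h1 hu.1
      unfold th; positivity
    have hInt1 := intervalIntegral.integrableOn_deriv_of_nonneg hcont hd hth
    have hI := intervalIntegral.integral_eq_sub_of_hasDerivAt_of_le h12 hcont hd
      ((intervalIntegrable_iff_integrableOn_Ioc_of_le h12).2 hInt1)
    have hnn : 0 ≤ ∫ u in n₁..n₂, th m u x := by
      rw [intervalIntegral.integral_of_le h12, integral_Ioc_eq_integral_Ioo]
      exact setIntegral_nonneg measurableSet_Ioo hth
    rw [← ofReal_integral_eq_lintegral_ofReal (hInt1.mono_set Ioo_subset_Ioc_self)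
      ((ae_restrict_iff' measurableSet_Ioo).2 (Filter.Eventually.of_forall hth)),
      ← integral_Ioc_eq_integral_Ioo, ← intervalIntegral.integral_of_le h12,
      ← ENNReal.ofReal_add (gg_nonneg _ _ _) hnn, hI]
    congr 1; ring
  have zero : ∀ u, m x ≤ u → gg m u x = 0 ∧ th m u x = 0 := by
    intro u hu
    constructor
    · apply Real.sqrt_eq_zero_of_nonpos
      have : 1 ≤ u ^ 2 / m x ^ 2 := by rw [le_div_iff₀ (by positivity)]; nlinarith
      linarith
    · rw [th, Real.sqrt_eq_zero_of_nonpos (by nlinarith)]; simp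
  rcases le_total n₂ (m x) with h | h
  · exact key _ _ h1 h12 h
  rcases le_total (m x) n₁ with h' | h'
  · have : ∫⁻ u in Ioo n₁ n₂, ENNReal.ofReal (th m u x) = 0 := by
      rw [← lintegral_zero (μ := volume.restrict (Ioo n₁ n₂))]
      exact setLIntegral_congr_fun measurableSet_Ioo
        (fun u hu => by simp [(zero u (h'.trans hu.1.le)).2])
    rw [this, (zero _ h').1, (zero _ h).1]; simp
  · rw [key n₁ (m x) h1 h' le_rfl, (zero _ h).1, (zero _ le_rfl).1]
    congr 1
    rw [← lintegral_indicator measurableSet_Ioo, ← lintegral_indicator measurableSet_Ioo]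
    congr 1
    ext u
    by_cases hu : u ∈ Ioo n₁ (m x)
    · rw [indicator_of_mem hu, indicator_of_mem (show u ∈ Ioo n₁ n₂ from ⟨hu.1, hu.2.trans_le h⟩)]
    · rw [indicator_of_notMem hu]
      by_cases hu2 : u ∈ Ioo n₁ n₂
      · rw [indicator_of_mem hu2, (zero u _).2]
        · simp
        · by_contra hc; exact hu ⟨hu2.1, not_le.1 hc⟩
      · rw [indicator_of_notMem hu2]

lemma GG_fubini {m : ℝ → ℝ} (hc : Continuous m) (hpos : ∀ t, 0 < m t) (x y : ℝ)
    {n₁ n₂ : ℝ} (h1 : 0 ≤ n₁) (h12 : n₁ ≤ n₂) :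
    ENNReal.ofReal |GG m n₁ x - GG m n₁ y| = ENNReal.ofReal |GG m n₂ x - GG m n₂ y| +
      ∫⁻ u in Ioo n₁ n₂, Th m u (uIoo x y) := by
  rw [GG_sub_lintegral hc hpos, GG_sub_lintegral hc hpos]
  have hmeas : Measurable (Function.uncurry fun (z u : ℝ) => ENNReal.ofReal (th m u z)) := by
    unfold th Function.uncurry
    have := hc.measurable
    fun_prop
  unfold Th
  rw [← lintegral_lintegral_swap hmeas.aemeasurable, ← lintegral_add_left]
  · exact lintegral_congr (fun z => th_ftc hpos z h1 h12)
  · exact ((gg_cont hc hpos n₂).measurable).ennreal_ofReal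

/-- Monotonicity of the angle integral. -/
lemma Th_anti {m : ℝ → ℝ} (hc : Continuous m) (hd : Differentiable ℝ m) (hpos : ∀ t, 0 < m t)
    {x R κ : ℝ}
    (hinj : InjOn m (uIoo x R)) (hne : ∀ t ∈ uIoo x R, deriv m t ≠ 0)
    (hκ : ∀ t ∈ uIoo x R, 0 < 1 - κ * m t ^ 2)
    (hβ : ∀ t ∈ uIoo x R, ∀ t' ∈ uIoo x R, m t ≤ m t' →
      Real.sqrt (1 - κ * m t' ^ 2) / |deriv m t'| ≤ Real.sqrt (1 - κ * m t ^ 2) / |deriv m t|)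
    (hivt : ∀ t' ∈ uIoo x R, ∀ y, m R < y → y < m t' → ∃ t ∈ uIoo x R, m t = y)
    {u u' : ℝ} (hu : m R ≤ u) (huu : u ≤ u') :
    Th m u' (uIoo x R) ≤ Th m u (uIoo x R) := by
  set S := uIoo x R with hS
  have hSm : MeasurableSet S := measurableSet_Ioo
  have hu0 : 0 < u := (hpos R).trans_le hu
  rcases huu.eq_or_lt with rfl | huu
  · rfl
  set τ : ℝ → ℝ := Function.invFunOn m S with hτ
  set β : ℝ → ℝ := fun t => Real.sqrt (1 - κ * m t ^ 2) / |deriv m t| with hβd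
  have hτm : ∀ t ∈ S, τ (m t) = t := fun t ht => hinj.leftInvOn_invFunOn ht
  have hκm : ∀ t ∈ S, κ < (m t ^ 2)⁻¹ := by
    intro t ht
    have h1 := hκ t ht
    have hm := hpos t
    rw [← one_div, lt_div_iff₀ (by positivity)]
    linarith
  have hVpos : ∀ v, 0 < v → ∀ t ∈ S, v < m t → 0 < (v ^ 2)⁻¹ - κ := by
    intro v hv t ht hvt
    have h1 := hκm t ht
    have h2 : (m t ^ 2)⁻¹ < (v ^ 2)⁻¹ := by
      apply inv_strictAnti₀ (by positivity); nlinarith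
    linarith
  -- for each level
  have level : ∀ v, 0 < v → Th m v S = ∫⁻ Y in (fun t => ((m t ^ 2)⁻¹ - κ) / ((v ^ 2)⁻¹ - κ)) ''
      (S ∩ {t | v < m t}), ENNReal.ofReal (β (τ (Real.sqrt ((Y * ((v ^ 2)⁻¹ - κ) + κ)⁻¹))) /
        (2 * Real.sqrt (Y * (1 - Y)))) := by
    intro v hv
    set S' := S ∩ {t | v < m t} with hS'
    have hS'm : MeasurableSet S' := hSm.inter (measurableSet_lt measurable_const hc.measurable)
    have hsub : Th m v S = ∫⁻ t in S', ENNReal.ofReal (th m v t) := by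
      unfold Th
      rw [← lintegral_indicator hSm, ← lintegral_indicator hS'm]
      congr 1
      ext t
      by_cases ht : t ∈ S
      · by_cases hvt : v < m t
        · rw [indicator_of_mem ht, indicator_of_mem (show t ∈ S' from ⟨ht, hvt⟩)]
        · rw [indicator_of_mem ht, indicator_of_notMem (show t ∉ S' from fun h => hvt h.2)]
          rw [th, Real.sqrt_eq_zero_of_nonpos]
          · simp
          · have := hpos t
            nlinarith [not_lt.1 hvt]
      · rw [indicator_of_notMem ht, indicator_of_notMem (show t ∉ S' from fun h => ht h.1)]
    rcases S'.eq_empty_or_nonempty with he | ⟨t₀, ht₀⟩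
    · rw [hsub, he]; simp
    have hV : 0 < (v ^ 2)⁻¹ - κ := hVpos v hv t₀ ht₀.1 ht₀.2
    set V := (v ^ 2)⁻¹ - κ with hVd
    rw [hsub, lintegral_image_eq_lintegral_abs_deriv_mul hS'm
      (f' := fun t => (-(2 * m t * deriv m t) / (m t ^ 2) ^ 2) / V)]
    · refine setLIntegral_congr_fun hS'm (fun t ht => ?_)
      have hm := hpos t
      have hvm : v < m t := ht.2
      have hW := hκ t ht.1
      have hmd := abs_pos.2 (hne t ht.1)
      have e1 : (((m t ^ 2)⁻¹ - κ) / V * V + κ)⁻¹ = m t ^ 2 := by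
        rw [div_mul_cancel₀ _ hV.ne']; simp
      have hQ : 0 < m t ^ 2 - v ^ 2 := by nlinarith
      have e2 : ((m t ^ 2)⁻¹ - κ) / V * (1 - ((m t ^ 2)⁻¹ - κ) / V) =
          ((1 - κ * m t ^ 2) * (m t ^ 2 - v ^ 2)) / (m t ^ 2 * v * V) ^ 2 := by
        have e3 : 1 - ((m t ^ 2)⁻¹ - κ) / V = (m t ^ 2 - v ^ 2) / (m t ^ 2 * v ^ 2 * V) := by
          have e4 : V - ((m t ^ 2)⁻¹ - κ) = (v ^ 2)⁻¹ - (m t ^ 2)⁻¹ := by rw [hVd]; ring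
          rw [one_sub_div hV.ne', e4]
          field_simp
        rw [e3]
        field_simp
      rw [e1, Real.sqrt_sq hm.le, hτm t ht.1, e2, Real.sqrt_div (by positivity),
        Real.sqrt_sq (by positivity), Real.sqrt_mul hW.le, ← ENNReal.ofReal_mul (abs_nonneg _),
        hβd, th]
      have hsW := Real.sqrt_pos.2 hW
      have hsQ := Real.sqrt_pos.2 hQ
      congr 1
      rw [abs_div, abs_div, abs_neg, abs_mul, abs_of_pos hV, abs_of_pos (by positivity : 0 < 2 * m t),
        abs_of_pos (by positivity : 0 < (m t ^ 2) ^ 2)]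
      simp only
      generalize Real.sqrt (1 - κ * m t ^ 2) = sW at hsW ⊢
      generalize Real.sqrt (m t ^ 2 - v ^ 2) = sQ at hsQ ⊢
      field_simp
    · intro t ht
      have hm := hpos t
      have h2 := ((hd t).hasDerivAt.pow 2).inv (pow_ne_zero 2 hm.ne')
      have := ((h2.sub_const κ).div_const V).hasDerivWithinAt (s := S')
      convert! this using 1
      simp
    · intro t ht t' ht' he
      apply hinj ht.1 ht'.1
      have hm := hpos t
      have hm' := hpos t'
      simp only at he
      rw [div_left_inj' hV.ne', sub_left_inj, inv_inj] at he
      exact (pow_left_inj₀ hm.le hm'.le (by norm_num)).1 he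
  rw [level u hu0, level u' (hu0.trans huu)]
  have hmu' : MeasurableSet (S ∩ {t | u' < m t}) :=
    hSm.inter (measurableSet_lt measurable_const hc.measurable)
  have main : ∀ Y ∈ (fun t => ((m t ^ 2)⁻¹ - κ) / ((u' ^ 2)⁻¹ - κ)) '' (S ∩ {t | u' < m t}),
      Y ∈ (fun t => ((m t ^ 2)⁻¹ - κ) / ((u ^ 2)⁻¹ - κ)) '' (S ∩ {t | u < m t}) ∧
      β (τ (Real.sqrt ((Y * ((u' ^ 2)⁻¹ - κ) + κ)⁻¹))) ≤
        β (τ (Real.sqrt ((Y * ((u ^ 2)⁻¹ - κ) + κ)⁻¹))) := by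
    rintro Y ⟨t', ⟨ht', hut'⟩, hY⟩
    have hut'' : u' < m t' := hut'
    simp only at hY
    have hm' := hpos t'
    have hu'0 := hu0.trans huu
    have hU' := hVpos u' hu'0 t' ht' hut'
    have hUU : (u' ^ 2)⁻¹ < (u ^ 2)⁻¹ := by
      apply inv_strictAnti₀ (by positivity); nlinarith
    have hmu : (m t' ^ 2)⁻¹ < (u' ^ 2)⁻¹ := by
      apply inv_strictAnti₀ (by positivity); nlinarith
    have hκ' := hκm t' ht'
    have hY0 : 0 < Y := by rw [← hY]; apply div_pos _ hU'; linarith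
    have hY1 : Y < 1 := by rw [← hY, div_lt_one hU']; linarith
    have eY : Y * ((u' ^ 2)⁻¹ - κ) + κ = (m t' ^ 2)⁻¹ := by
      rw [← hY, div_mul_cancel₀ _ hU'.ne']; ring
    set Z := Y * ((u ^ 2)⁻¹ - κ) + κ with hZ
    have hZ1 : (m t' ^ 2)⁻¹ < Z := by
      rw [← eY, hZ]; nlinarith
    have hZ0 : 0 < Z := lt_trans (by positivity) hZ1
    have hZ2 : Z < (u ^ 2)⁻¹ := by rw [hZ]; nlinarith
    have hy1 : Real.sqrt Z⁻¹ < m t' := by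
      rw [Real.sqrt_lt' hm']
      rw [inv_lt_comm₀ hZ0 (by positivity)]; exact hZ1
    have hy2 : u < Real.sqrt Z⁻¹ := by
      rw [Real.lt_sqrt hu0.le]
      rw [lt_inv_comm₀ (by positivity) hZ0]; exact hZ2
    obtain ⟨t, ht, htm⟩ := hivt t' ht' _ (hu.trans_lt hy2) hy1
    refine ⟨⟨t, ⟨ht, by simpa [htm] using hy2⟩, ?_⟩, ?_⟩
    · simp only
      rw [htm, Real.sq_sqrt (by positivity), inv_inv, hZ, add_sub_cancel_right,
        mul_div_cancel_right₀]
      linarith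
    · rw [eY, inv_inv, Real.sqrt_sq hm'.le, hτm t' ht', ← htm, hτm t ht]
      exact hβ t ht t' ht' (htm ▸ hy1.le)
  refine le_trans ?_ (lintegral_mono_set fun Y hY => (main Y hY).1)
  have hcY : Measurable (fun t => ((m t ^ 2)⁻¹ - κ) / ((u' ^ 2)⁻¹ - κ)) := by
    have := hc.measurable
    fun_prop
  refine lintegral_mono_ae ?_
  refine (ae_restrict_iff'₀ ?_).2 (Filter.Eventually.of_forall fun Y hY => ?_)
  · refine (hmu'.image_of_measurable_injOn hcY ?_).nullMeasurableSet
    intro t ht t' ht' he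
    apply hinj ht.1 ht'.1
    have hm := hpos t
    have hm' := hpos t'
    have hU' := hVpos u' (hu0.trans huu) t ht.1 ht.2
    simp only at he
    rw [div_left_inj' hU'.ne', sub_left_inj, inv_inj] at he
    exact (pow_left_inj₀ hm.le hm'.le (by norm_num)).1 he
  · apply ENNReal.ofReal_le_ofReal
    gcongr
    exact (main Y hY).2

lemma key_ineq {m : ℝ → ℝ} (hc : Continuous m) (hpos : ∀ t, 0 < m t) {x R : ℝ}
    (hanti : ∀ u u', m R ≤ u → u ≤ u' → Th m u' (uIoo x R) ≤ Th m u (uIoo x R))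
    {n n' Δ : ℝ} (hn : m R ≤ n) (hn' : m R ≤ n') (hΔ0 : 0 ≤ Δ)
    (hΔ : ENNReal.ofReal Δ ≤ Th m n (uIoo x R))
    (hΔ' : n < n' → Th m n (uIoo x R) = ENNReal.ofReal Δ) :
    |GG m n x - GG m n R| + (n - n') * Δ ≤ |GG m n' x - GG m n' R| := by
  have hR := hpos R
  rcases le_or_gt n' n with h | h
  · have hF := GG_fubini hc hpos x R (n₁ := n') (n₂ := n) (by linarith) h
    have hle : ENNReal.ofReal Δ * ENNReal.ofReal (n - n') ≤
        ∫⁻ u in Ioo n' n, Th m u (uIoo x R) := by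
      have : ∫⁻ u in Ioo n' n, ENNReal.ofReal Δ = ENNReal.ofReal Δ * ENNReal.ofReal (n - n') := by
        simp
      rw [← this]
      exact setLIntegral_mono' measurableSet_Ioo
        (fun u hu => hΔ.trans (hanti u n (hn'.trans hu.1.le) hu.2.le))
    rw [← ENNReal.ofReal_mul hΔ0] at hle
    have h2 : ENNReal.ofReal (|GG m n x - GG m n R| + Δ * (n - n')) ≤
        ENNReal.ofReal |GG m n' x - GG m n' R| := by
      rw [hF, ENNReal.ofReal_add (abs_nonneg _) (mul_nonneg hΔ0 (by linarith))]
      gcongr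
    have h3 := (ENNReal.ofReal_le_ofReal_iff (abs_nonneg _)).1 h2
    linarith
  · have hF := GG_fubini hc hpos x R (n₁ := n) (n₂ := n') (by linarith) h.le
    have hle : ∫⁻ u in Ioo n n', Th m u (uIoo x R) ≤
        ENNReal.ofReal Δ * ENNReal.ofReal (n' - n) := by
      have : ∫⁻ u in Ioo n n', ENNReal.ofReal Δ = ENNReal.ofReal Δ * ENNReal.ofReal (n' - n) := by
        simp
      rw [← this]
      exact setLIntegral_mono' measurableSet_Ioo
        (fun u hu => (hanti n u hn hu.1.le).trans (hΔ' h).le)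
    rw [← ENNReal.ofReal_mul hΔ0] at hle
    have h2 : ENNReal.ofReal |GG m n x - GG m n R| ≤
        ENNReal.ofReal (|GG m n' x - GG m n' R| + Δ * (n' - n)) := by
      rw [hF, ENNReal.ofReal_add (abs_nonneg _) (mul_nonneg hΔ0 (by linarith))]
      gcongr
    have h3 := (ENNReal.ofReal_le_ofReal_iff
      (add_nonneg (abs_nonneg _) (mul_nonneg hΔ0 (by linarith)))).1 h2
    linarith
end CutAux

namespace CutAux
open MeasureTheory

lemma gg_sq {m : ℝ → ℝ} (hpos : ∀ t, 0 < m t) {n x : ℝ} (hn : 0 ≤ n) (h : n ≤ m x) :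
    gg m n x ^ 2 = 1 - n ^ 2 / m x ^ 2 := by
  apply Real.sq_sqrt
  have := hpos x
  have : n ^ 2 / m x ^ 2 ≤ 1 := by rw [div_le_one (by positivity)]; gcongr
  linarith

lemma speed_lb {m : ℝ → ℝ} (hpos : ∀ t, 0 < m t) {n x v w e₁ e₂ : ℝ} (hn : 0 ≤ n)
    (h : n ≤ m x) (h1 : e₁ ^ 2 = 1) (h2 : e₂ ^ 2 = 1) :
    e₁ * (n * w) + e₂ * (gg m n x * v) ≤ Real.sqrt (v ^ 2 + m x ^ 2 * w ^ 2) := by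
  apply Real.le_sqrt_of_sq_le
  have hm := hpos x
  have hg := gg_sq hpos hn h
  set g := gg m n x
  obtain ⟨k, hk⟩ : ∃ k, n = k * m x := ⟨n / m x, by field_simp⟩
  have hg' : g ^ 2 = 1 - k ^ 2 := by rw [hg, hk]; field_simp
  rw [hk]
  have e3 : (e₁ * e₂) ^ 2 = 1 := by rw [mul_pow, h1, h2]; norm_num
  have h4 : v ^ 2 + m x ^ 2 * w ^ 2 - (e₁ * (k * m x * w) + e₂ * (g * v)) ^ 2 =
      (k * v - (e₁ * e₂) * (g * (m x * w))) ^ 2 := by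
    linear_combination (-(k * m x * w) ^ 2) * h1 - (g * v) ^ 2 * h2
      - (g * (m x * w)) ^ 2 * e3 - (v ^ 2 + m x ^ 2 * w ^ 2) * hg'
  nlinarith [sq_nonneg (k * v - (e₁ * e₂) * (g * (m x * w)))]

lemma abs_eq_sign (x : ℝ) : ∃ e : ℝ, e ^ 2 = 1 ∧ |x| = e * x := by
  rcases abs_choice x with h | h
  · exact ⟨1, by norm_num, by simpa using h⟩
  · exact ⟨-1, by norm_num, by simpa using h⟩

lemma fst_hasDeriv {c : ℝ → ℝ × ℝ} (hcd : ContDiff ℝ 1 c) :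
    ContDiff ℝ 1 (fun u => (c u).1) ∧ ContDiff ℝ 1 (fun u => (c u).2) :=
  ⟨contDiff_fst.comp hcd, contDiff_snd.comp hcd⟩

lemma curve_cont {m : ℝ → ℝ} (hc : Continuous m) {c : ℝ → ℝ × ℝ} (hcd : ContDiff ℝ 1 c) :
    Continuous (fun s => Real.sqrt ((deriv (fun u => (c u).1) s) ^ 2 +
      (m (c s).1) ^ 2 * (deriv (fun u => (c u).2) s) ^ 2)) := by
  obtain ⟨h1, h2⟩ := fst_hasDeriv hcd
  have d1 := h1.continuous_deriv le_rfl
  have d2 := h2.continuous_deriv le_rfl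
  have := h1.continuous
  fun_prop

lemma curve_lb_seg {m : ℝ → ℝ} (hc : Continuous m) (hpos : ∀ t, 0 < m t)
    {c : ℝ → ℝ × ℝ} (hcd : ContDiff ℝ 1 c) {a b n : ℝ} (hab : a ≤ b) (hn : 0 ≤ n)
    (hmn : ∀ s ∈ Icc a b, n ≤ m (c s).1) :
    n * |(c b).2 - (c a).2| + |GG m n (c b).1 - GG m n (c a).1| ≤ wLength m c a b := by
  obtain ⟨h1, h2⟩ := fst_hasDeriv hcd
  have d1 := h1.continuous_deriv le_rfl
  have d2 := h2.continuous_deriv le_rfl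
  have c1 := h1.continuous
  have hd1 : ∀ s, HasDerivAt (fun u => (c u).1) (deriv (fun u => (c u).1) s) s :=
    fun s => ((h1.differentiable (by norm_num)) s).hasDerivAt
  have hd2 : ∀ s, HasDerivAt (fun u => (c u).2) (deriv (fun u => (c u).2) s) s :=
    fun s => ((h2.differentiable (by norm_num)) s).hasDerivAt
  obtain ⟨e₁, he1, hE1⟩ := abs_eq_sign ((c b).2 - (c a).2)
  obtain ⟨e₂, he2, hE2⟩ := abs_eq_sign (GG m n (c b).1 - GG m n (c a).1)
  have hg := gg_cont hc hpos n
  have hder : ∀ s, HasDerivAt (fun s => e₁ * (n * (c s).2) + e₂ * GG m n (c s).1)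
      (e₁ * (n * deriv (fun u => (c u).2) s) +
        e₂ * (gg m n (c s).1 * deriv (fun u => (c u).1) s)) s := by
    intro s
    have h3 : HasDerivAt (fun s => GG m n (c s).1)
        (gg m n (c s).1 * deriv (fun u => (c u).1) s) s :=
      HasDerivAt.comp (h₂ := GG m n) (h := fun u => (c u).1) s (GG_deriv hc hpos n (c s).1) (hd1 s)
    exact (((hd2 s).const_mul n).const_mul e₁).add (h3.const_mul e₂)
  have hco : Continuous (fun s => e₁ * (n * deriv (fun u => (c u).2) s) +
        e₂ * (gg m n (c s).1 * deriv (fun u => (c u).1) s)) := by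
    have := hg.comp c1
    simp only [Function.comp_def] at this
    fun_prop
  have hI := intervalIntegral.integral_eq_sub_of_hasDerivAt (fun s _ => hder s)
    (hco.intervalIntegrable a b)
  have : n * |(c b).2 - (c a).2| + |GG m n (c b).1 - GG m n (c a).1| =
      ∫ s in a..b, (e₁ * (n * deriv (fun u => (c u).2) s) +
        e₂ * (gg m n (c s).1 * deriv (fun u => (c u).1) s)) := by
    rw [hI, hE1, hE2]; ring
  rw [this, wLength]
  exact intervalIntegral.integral_mono_on hab (hco.intervalIntegrable a b)
    ((curve_cont hc hcd).intervalIntegrable a b)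
    (fun s hs => speed_lb hpos hn (hmn s hs) he1 he2)

lemma curve_lb {m : ℝ → ℝ} (hc : Continuous m) (hpos : ∀ t, 0 < m t)
    (hev : ∀ t, m (-t) = m t)
    {c : ℝ → ℝ × ℝ} (hcd : ContDiff ℝ 1 c) {B n s₀ : ℝ} (hn : 0 ≤ n) (hs : s₀ ∈ Icc 0 B)
    (hmn : ∀ s ∈ Icc 0 B, n ≤ m (c s).1) :
    n * |(c B).2 - (c 0).2| + |GG m n (|(c 0).1|) - GG m n (|(c s₀).1|)|
      + |GG m n (|(c B).1|) - GG m n (|(c s₀).1|)| ≤ wLength m c 0 B := by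
  have h1 := curve_lb_seg hc hpos hcd hs.1 hn (fun s h => hmn s ⟨h.1, h.2.trans hs.2⟩)
  have h2 := curve_lb_seg hc hpos hcd hs.2 hn (fun s h => hmn s ⟨hs.1.trans h.1, h.2⟩)
  have h3 : wLength m c 0 B = wLength m c 0 s₀ + wLength m c s₀ B :=
    (intervalIntegral.integral_add_adjacent_intervals
      ((curve_cont hc hcd).intervalIntegrable _ _)
      ((curve_cont hc hcd).intervalIntegrable _ _)).symm
  have h4 := GG_abs_sub hc hpos hev n (c s₀).1 (c 0).1
  have h5 := GG_abs_sub hc hpos hev n (c B).1 (c s₀).1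
  rw [abs_sub_comm] at h4
  have h6 : n * |(c B).2 - (c 0).2| ≤ n * |(c s₀).2 - (c 0).2| + n * |(c B).2 - (c s₀).2| := by
    rw [← mul_add]
    gcongr
    have := abs_add_le ((c s₀).2 - (c 0).2) ((c B).2 - (c s₀).2)
    rwa [show (c s₀).2 - (c 0).2 + ((c B).2 - (c s₀).2) = (c B).2 - (c 0).2 by ring] at this
  linarith

lemma GG_eq_of {m : ℝ → ℝ} (hpos : ∀ t, 0 < m t) (hc : Continuous m) {n a b : ℝ}
    (h : ∀ t ∈ uIcc a b, m t ≤ n) : GG m n a = GG m n b := by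
  have h1 := gg_cont hc hpos n
  have : GG m n b - GG m n a = ∫ y in a..b, gg m n y := by
    unfold GG
    exact intervalIntegral.integral_interval_sub_left (h1.intervalIntegrable _ _)
      (h1.intervalIntegrable _ _)
  rw [intervalIntegral.integral_congr (g := fun _ => (0:ℝ))] at this
  · simp at this; linarith
  · intro t ht
    apply Real.sqrt_eq_zero_of_nonpos
    have hm := hpos t
    have := h t ht
    have : 1 ≤ n ^ 2 / m t ^ 2 := by rw [le_div_iff₀ (by positivity)]; nlinarith
    linarith

lemma Th_eq_of {m : ℝ → ℝ} (hpos : ∀ t, 0 < m t) {n x r R : ℝ}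
    (hr : r ∈ uIcc x R) (h : ∀ t ∈ uIcc r R, m t ≤ n) :
    Th m n (uIoo x R) = Th m n (uIoo x r) := by
  unfold Th
  have hm1 : MeasurableSet (uIoo x R) := measurableSet_Ioo
  have hm2 : MeasurableSet (uIoo x r) := measurableSet_Ioo
  rw [← lintegral_indicator hm1, ← lintegral_indicator hm2]
  congr 1
  ext t
  by_cases ht : t ∈ uIoo x r
  · have ht' : t ∈ uIoo x R := by
      rw [uIoo_eq_union] at ht ⊢
      rw [mem_uIcc] at hr
      simp only [mem_union, mem_Ioo] at ht ⊢
      grind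
    rw [indicator_of_mem ht, indicator_of_mem ht']
  · rw [indicator_of_notMem ht]
    by_cases ht' : t ∈ uIoo x R
    · rw [indicator_of_mem ht']
      have : t ∈ uIcc r R := by
        rw [uIoo_eq_union] at ht ht'
        rw [mem_uIcc] at hr ⊢
        simp only [mem_union, mem_Ioo] at ht ht'
        grind
      have h1 := h t this
      have hm := hpos t
      rw [th, Real.sqrt_eq_zero_of_nonpos (by nlinarith)]
      simp
    · rw [indicator_of_notMem ht']

structure Geo (m T T' θ θ' : ℝ → ℝ) (ν : ℝ) : Prop where
  dT : ∀ s, HasDerivAt T (T' s) s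
  dT' : ∀ s, HasDerivAt T' (m (T s) * deriv m (T s) * θ' s ^ 2) s
  dth : ∀ s, HasDerivAt θ (θ' s) s
  clair : ∀ s, m (T s) ^ 2 * θ' s = ν
  unit : ∀ s, T' s ^ 2 + m (T s) ^ 2 * θ' s ^ 2 = 1

lemma Geo.th' {m T T' θ θ' : ℝ → ℝ} {ν : ℝ} (G : Geo m T T' θ θ' ν) (hpos : ∀ t, 0 < m t)
    (s : ℝ) : θ' s = ν / m (T s) ^ 2 := by
  have := hpos (T s)
  rw [← G.clair s]; field_simp

lemma Geo.sq {m T T' θ θ' : ℝ → ℝ} {ν : ℝ} (G : Geo m T T' θ θ' ν) (hpos : ∀ t, 0 < m t)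
    (s : ℝ) : T' s ^ 2 = 1 - |ν| ^ 2 / m (T s) ^ 2 := by
  have hm := hpos (T s)
  have h := G.unit s
  rw [G.th' hpos] at h
  rw [sq_abs]
  field_simp at h ⊢
  linarith

lemma Geo.le {m T T' θ θ' : ℝ → ℝ} {ν : ℝ} (G : Geo m T T' θ θ' ν) (hpos : ∀ t, 0 < m t)
    (s : ℝ) : |ν| ≤ m (T s) := by
  have hm := hpos (T s)
  have h := G.sq hpos s
  have h2 : |ν| ^ 2 / m (T s) ^ 2 ≤ 1 := by nlinarith [sq_nonneg (T' s)]
  rw [div_le_one (by positivity)] at h2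
  exact (pow_le_pow_iff_left₀ (abs_nonneg _) hm.le (by norm_num)).1 h2

lemma Geo.gg {m T T' θ θ' : ℝ → ℝ} {ν : ℝ} (G : Geo m T T' θ θ' ν) (hpos : ∀ t, 0 < m t)
    (s : ℝ) : gg m |ν| (T s) = |T' s| := by
  unfold CutAux.gg
  rw [← G.sq hpos, Real.sqrt_sq_eq_abs]

lemma Geo.turn {m T T' θ θ' : ℝ → ℝ} {ν : ℝ} (G : Geo m T T' θ θ' ν) (hpos : ∀ t, 0 < m t)
    {s : ℝ} (h : T' s = 0) : m (T s) = |ν| := by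
  have hm := hpos (T s)
  have h1 := G.sq hpos s
  rw [h] at h1
  have h2 : |ν| ^ 2 = m (T s) ^ 2 := by field_simp at h1; linarith
  exact ((pow_left_inj₀ (abs_nonneg _) hm.le (by norm_num)).1 h2).symm

lemma Geo.seg {m T T' θ θ' : ℝ → ℝ} {ν : ℝ} (hc : Continuous m) (hpos : ∀ t, 0 < m t)
    (G : Geo m T T' θ θ' ν) {a b : ℝ} (hab : a ≤ b)
    (hs : (∀ s ∈ Ioo a b, 0 < T' s) ∨ (∀ s ∈ Ioo a b, T' s < 0)) :
    (b - a = |ν| * |θ b - θ a| + |GG m (|ν|) (T b) - GG m (|ν|) (T a)|) ∧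
    Th m |ν| (uIoo (T a) (T b)) = ENNReal.ofReal |θ b - θ a| ∧
    ν * (θ b - θ a) = |ν| * |θ b - θ a| := by
  have hTc : Continuous T := continuous_iff_continuousAt.2 fun s => (G.dT s).continuousAt
  have hT'c : Continuous T' := continuous_iff_continuousAt.2 fun s => (G.dT' s).continuousAt
  have hth : θ' = fun s => ν / m (T s) ^ 2 := funext (G.th' hpos)
  have hth'c : Continuous θ' := by
    rw [hth]
    have : ∀ s, m (T s) ^ 2 ≠ 0 := fun s => pow_ne_zero _ (hpos _).ne'
    fun_prop (disch := assumption)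
  obtain ⟨e, he, hes⟩ : ∃ e : ℝ, e ^ 2 = 1 ∧ ∀ s ∈ Ioo a b, |T' s| = e * T' s := by
    rcases hs with h | h
    · exact ⟨1, by norm_num, fun s hs => by rw [abs_of_pos (h s hs), one_mul]⟩
    · exact ⟨-1, by norm_num, fun s hs => by rw [abs_of_neg (h s hs)]; ring⟩
  have hν : ν * (θ b - θ a) = ∫ s in a..b, ν * θ' s := by
    rw [intervalIntegral.integral_const_mul,
      intervalIntegral.integral_eq_sub_of_hasDerivAt (fun s _ => G.dth s)
      (hth'c.intervalIntegrable a b)]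
  have hGG : e * (GG m |ν| (T b) - GG m |ν| (T a)) = ∫ s in a..b, e * (CutAux.gg m |ν| (T s) * T' s) := by
    have hco : Continuous fun s => CutAux.gg m |ν| (T s) * T' s :=
      ((gg_cont hc hpos |ν|).comp hTc).mul hT'c
    rw [intervalIntegral.integral_const_mul,
      intervalIntegral.integral_eq_sub_of_hasDerivAt
      (fun s _ => (GG_deriv hc hpos |ν| (T s)).comp s (G.dT s))
      (hco.intervalIntegrable a b)]
    rfl
  have hco1 : Continuous fun s => ν * θ' s := by fun_prop
  have hco2 : Continuous fun s => e * (CutAux.gg m |ν| (T s) * T' s) :=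
    (((gg_cont hc hpos |ν|).comp hTc).mul hT'c).const_mul e
  have p1 : ∀ s, ν * θ' s = m (T s) ^ 2 * θ' s ^ 2 := fun s => by rw [← G.clair s]; ring
  have p2 : ∀ s ∈ Ioo a b, e * (CutAux.gg m |ν| (T s) * T' s) = T' s ^ 2 := fun s hs => by
    rw [G.gg hpos, ← sq_abs (T' s), pow_two, hes s hs]; ring
  have n1 : 0 ≤ ν * (θ b - θ a) := by
    rw [hν]
    exact intervalIntegral.integral_nonneg hab (fun s _ => by rw [p1]; positivity)
  have n2 : 0 ≤ e * (GG m |ν| (T b) - GG m |ν| (T a)) := by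
    rw [hGG, intervalIntegral.integral_of_le hab, integral_Ioc_eq_integral_Ioo]
    exact setIntegral_nonneg measurableSet_Ioo (fun s hs => by rw [p2 s hs]; positivity)
  have q1 : ν * (θ b - θ a) = |ν| * |θ b - θ a| := by rw [← abs_mul, abs_of_nonneg n1]
  have q2 : e * (GG m |ν| (T b) - GG m |ν| (T a)) = |GG m (|ν|) (T b) - GG m (|ν|) (T a)| := by
    rw [← abs_of_nonneg n2, abs_mul]
    have : |e| = 1 := by rw [← sq_eq_sq₀ (abs_nonneg _) (by norm_num), sq_abs, he]; norm_num
    rw [this, one_mul]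
  refine ⟨?_, ?_, q1⟩
  · rw [← q1, ← q2, hν, hGG, ← intervalIntegral.integral_add (hco1.intervalIntegrable _ _)
      (hco2.intervalIntegrable _ _), intervalIntegral.integral_of_le hab,
      integral_Ioc_eq_integral_Ioo, setIntegral_congr_fun (g := fun _ => (1:ℝ)) measurableSet_Ioo]
    · simp [hab]
    · intro s hs
      simp only
      rw [p1, p2 s hs]; linarith [G.unit s]
  · have himg : T '' Ioo a b = uIoo (T a) (T b) ∧ InjOn T (Ioo a b) := by
      rcases hs with h | h
      · have hmono : StrictMonoOn T (Icc a b) := by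
          apply strictMonoOn_of_deriv_pos (convex_Icc a b) hTc.continuousOn
          intro s hs; rw [interior_Icc] at hs; rw [(G.dT s).deriv]; exact h s hs
        refine ⟨?_, hmono.injOn.mono Ioo_subset_Icc_self⟩
        rw [uIoo_of_le (hmono.monotoneOn (left_mem_Icc.2 hab) (right_mem_Icc.2 hab) hab)]
        apply Subset.antisymm
        · rintro _ ⟨s, hs, rfl⟩
          exact ⟨hmono (left_mem_Icc.2 hab) (Ioo_subset_Icc_self hs) hs.1,
            hmono (Ioo_subset_Icc_self hs) (right_mem_Icc.2 hab) hs.2⟩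
        · exact intermediate_value_Ioo hab hTc.continuousOn
      · have hmono : StrictAntiOn T (Icc a b) := by
          apply strictAntiOn_of_deriv_neg (convex_Icc a b) hTc.continuousOn
          intro s hs; rw [interior_Icc] at hs; rw [(G.dT s).deriv]; exact h s hs
        refine ⟨?_, hmono.injOn.mono Ioo_subset_Icc_self⟩
        rw [uIoo_of_ge (hmono.antitoneOn (left_mem_Icc.2 hab) (right_mem_Icc.2 hab) hab)]
        apply Subset.antisymm
        · rintro _ ⟨s, hs, rfl⟩
          exact ⟨hmono (Ioo_subset_Icc_self hs) (right_mem_Icc.2 hab) hs.2,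
            hmono (left_mem_Icc.2 hab) (Ioo_subset_Icc_self hs) hs.1⟩
        · exact intermediate_value_Ioo' hab hTc.continuousOn
    have hne : ∀ s ∈ Ioo a b, T' s ≠ 0 := by
      rcases hs with h | h
      · exact fun s hs => (h s hs).ne'
      · exact fun s hs => (h s hs).ne
    rw [← himg.1]
    unfold Th
    rw [lintegral_image_eq_lintegral_abs_deriv_mul measurableSet_Ioo
      (fun s _ => (G.dT s).hasDerivWithinAt) himg.2]
    have hpt : ∀ s ∈ Ioo a b, ENNReal.ofReal |T' s| * ENNReal.ofReal (th m |ν| (T s)) =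
        ENNReal.ofReal (|ν| / m (T s) ^ 2) := by
      intro s hs
      rw [← ENNReal.ofReal_mul (abs_nonneg _)]
      congr 1
      have hm := hpos (T s)
      have hT := abs_pos.2 (hne s hs)
      have h1 : m (T s) ^ 2 - |ν| ^ 2 = (m (T s) * |T' s|) ^ 2 := by
        rw [mul_pow, sq_abs (T' s), G.sq hpos]; field_simp
      rw [th, h1, Real.sqrt_sq (by positivity)]
      field_simp
    rw [setLIntegral_congr_fun measurableSet_Ioo hpt]
    have hcc : Continuous fun s => |ν| / m (T s) ^ 2 := by
      have : ∀ s, m (T s) ^ 2 ≠ 0 := fun s => pow_ne_zero _ (hpos _).ne'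
      fun_prop (disch := assumption)
    rw [← ofReal_integral_eq_lintegral_ofReal]
    · congr 1
      rw [← integral_Ioc_eq_integral_Ioo, ← intervalIntegral.integral_of_le hab]
      have : θ b - θ a = ∫ s in a..b, ν / m (T s) ^ 2 := by
        rw [← hth, intervalIntegral.integral_eq_sub_of_hasDerivAt (fun s _ => G.dth s)
          (hth'c.intervalIntegrable a b)]
      rw [this]
      simp only [div_eq_mul_inv]
      rw [intervalIntegral.integral_const_mul, intervalIntegral.integral_const_mul, abs_mul]
      congr 1
      rw [abs_of_nonneg]
      exact intervalIntegral.integral_nonneg hab (fun s _ => by positivity)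
    · exact hcc.integrableOn_Icc.mono_set Ioo_subset_Icc_self
    · exact Filter.Eventually.of_forall fun s => by positivity
end CutAux

namespace CutAux
open MeasureTheory

lemma geo_const {m T T' θ θ' : ℝ → ℝ} {ν : ℝ} (hm : ContDiff ℝ (⊤:ℕ∞) m)
    (hpos : ∀ t, 0 < m t) (G : Geo m T T' θ θ' ν) {s₀ : ℝ} (h0 : T' s₀ = 0)
    (h1 : deriv m (T s₀) = 0) (s : ℝ) : T s = T s₀ := by
  have hTc : Continuous T := continuous_iff_continuousAt.2 fun s => (G.dT s).continuousAt
  have hT'c : Continuous T' := continuous_iff_continuousAt.2 fun s => (G.dT' s).continuousAt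
  let v : ℝ × ℝ → ℝ × ℝ := fun z => (z.2, ν ^ 2 * deriv m z.1 / m z.1 ^ 3)
  have hdm : ContDiff ℝ 1 (deriv m) :=
    ContDiff.of_le (n := (⊤:ℕ∞)) (ContDiff.deriv' (hm)) (by exact_mod_cast le_top)
  have hm1 : ContDiff ℝ 1 m := hm.of_le (by exact_mod_cast le_top)
  have hv : ContDiff ℝ 1 v := by
    apply ContDiff.prodMk contDiff_snd
    apply ContDiff.div
    · exact contDiff_const.mul (hdm.comp contDiff_fst)
    · exact (hm1.comp contDiff_fst).pow 3
    · intro z; exact pow_ne_zero _ (hpos _).ne'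
  set a := min s s₀ - 1
  set b := max s s₀ + 1
  let f : ℝ → ℝ × ℝ := fun u => (T u, T' u)
  have hfc : Continuous f := hTc.prodMk hT'c
  have hs0 : s₀ ∈ Ioo a b := ⟨by have := min_le_right s s₀; simp only [a]; linarith,
    by have := le_max_right s s₀; simp only [b]; linarith⟩
  have hs : s ∈ Ioo a b := ⟨by have := min_le_left s s₀; simp only [a]; linarith,
    by have := le_max_left s s₀; simp only [b]; linarith⟩
  have hK : IsCompact (f '' Icc a b) := isCompact_Icc.image hfc
  obtain ⟨K, hL⟩ := LocallyLipschitzOn.exists_lipschitzOnWith_of_compact hK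
    (hv.locallyLipschitz.locallyLipschitzOn)
  have := ODE_solution_unique_of_mem_Ioo (v := fun _ => v) (s := fun _ => f '' Icc a b)
    (f := f) (g := fun _ => f s₀) (fun t _ => hL) hs0 (fun t ht => ⟨?_, ?_⟩)
    (fun t ht => ⟨?_, ?_⟩) rfl hs
  · exact congrArg Prod.fst this
  · have h2 := (G.dT t).prodMk (G.dT' t)
    convert! h2 using 2
    have hmt := hpos (T t)
    simp only [f]
    rw [G.th' hpos]
    field_simp
  · exact ⟨t, Ioo_subset_Icc_self ht, rfl⟩
  · have : v (f s₀) = 0 := by simp [v, f, h0, h1]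
    rw [this]; exact hasDerivAt_const _ _
  · exact ⟨s₀, Ioo_subset_Icc_self hs0, rfl⟩

lemma Th_mono_set {m : ℝ → ℝ} {u : ℝ} {S S' : Set ℝ} (h : S ⊆ S') : Th m u S ≤ Th m u S' :=
  lintegral_mono_set h

lemma core {m T T' θ θ' : ℝ → ℝ} {ν : ℝ} (hc : Continuous m) (hpos : ∀ t, 0 < m t)
    (hev : ∀ t, m (-t) = m t) (G : Geo m T T' θ θ' ν) {b R : ℝ} (hb : 0 ≤ b) (hν : m R ≤ |ν|)
    (han0 : ∀ u u', m R ≤ u → u ≤ u' → Th m u' (uIoo (T 0) R) ≤ Th m u (uIoo (T 0) R))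
    (hanb : ∀ u u', m R ≤ u → u ≤ u' → Th m u' (uIoo (T b) R) ≤ Th m u (uIoo (T b) R))
    (hside : (T 0 ≤ R ∧ T b ≤ R) ∨ (R ≤ T 0 ∧ R ≤ T b))
    (hsig : ((∀ s ∈ Ioo 0 b, 0 < T' s) ∨ (∀ s ∈ Ioo 0 b, T' s < 0)) ∨
      ∃ s0 ∈ Icc 0 b, T' s0 = 0 ∧
        ((∀ s ∈ Ioo 0 s0, 0 < T' s) ∨ (∀ s ∈ Ioo 0 s0, T' s < 0)) ∧
        ((∀ s ∈ Ioo s0 b, 0 < T' s) ∨ (∀ s ∈ Ioo s0 b, T' s < 0)) ∧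
        T s0 ∈ uIcc (T 0) R ∧ T s0 ∈ uIcc (T b) R ∧ ∀ t ∈ uIcc (T s0) R, m t ≤ |ν|)
    {c : ℝ → ℝ × ℝ} (hcd : ContDiff ℝ 1 c) {B s₁ n' : ℝ} (hs₁ : s₁ ∈ Icc 0 B)
    (hn' : m R ≤ n') (hmn : ∀ s ∈ Icc 0 B, n' ≤ m (c s).1)
    (hA0 : |GG m n' (T 0) - GG m n' R| ≤ |GG m n' (T 0) - GG m n' (|(c s₁).1|)|)
    (hAb : |GG m n' (T b) - GG m n' R| ≤ |GG m n' (T b) - GG m n' (|(c s₁).1|)|)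
    (e0 : |(c 0).1| = T 0) (eb : |(c B).1| = T b) (eth : (c B).2 - (c 0).2 = θ b - θ 0) :
    b ≤ wLength m c 0 B := by
  have hR := hpos R
  have hB : (0:ℝ) ≤ B := hs₁.1.trans hs₁.2
  set n := |ν| with hnd
  have hn0 : 0 < n := hR.trans_le hν
  have hL := curve_lb hc hpos hev hcd (n := n') (by linarith) hs₁ hmn
  rw [e0, eb, eth] at hL
  rcases hsig with hsig | ⟨s0, hs0, hT0, hsa, hsb, hr0, hrb, hrm⟩
  · obtain ⟨g1, g2, g3⟩ := G.seg hc hpos hb hsig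
    rw [← hnd] at g1 g2 g3
    rcases le_or_gt n n' with h | h
    · have hL := curve_lb hc hpos hev hcd (n := n) hn0.le (left_mem_Icc.2 hB)
        (fun s hs => h.trans (hmn s hs))
      rw [e0, eb, eth] at hL
      simp only [sub_self, abs_zero] at hL
      linarith
    · set Δ := |θ b - θ 0| with hΔ
      have z0 : 0 ≤ Δ := abs_nonneg _
      have tri : |GG m n (T b) - GG m n (T 0)| ≤
          |GG m n (T 0) - GG m n R| + |GG m n (T b) - GG m n R| := by
        have := abs_sub_le (GG m n (T b)) (GG m n R) (GG m n (T 0))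
        rw [abs_sub_comm (GG m n R)] at this
        linarith
      have hz : ∀ S, ENNReal.ofReal 0 ≤ Th m n S := by intro S; simp
      have hor : uIoo (T 0) (T b) ⊆ uIoo (T 0) R ∨ uIoo (T 0) (T b) ⊆ uIoo (T b) R := by
        simp only [uIoo_eq_union]
        rcases hside with ⟨h1, h2⟩ | ⟨h1, h2⟩ <;> rcases le_total (T 0) (T b) with h3 | h3
        · left; intro t; simp only [mem_union, mem_Ioo]; grind
        · right; intro t; simp only [mem_union, mem_Ioo]; grind
        · right; intro t; simp only [mem_union, mem_Ioo]; grind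
        · left; intro t; simp only [mem_union, mem_Ioo]; grind
      rcases hor with hs | hs
      · have k1 := key_ineq hc hpos han0 hν hn' z0 (g2 ▸ Th_mono_set hs) (fun h' => absurd h' h.not_gt)
        have k2 := key_ineq hc hpos hanb hν hn' le_rfl (hz _) (fun h' => absurd h' h.not_gt)
        linarith
      · have k1 := key_ineq hc hpos hanb hν hn' z0 (g2 ▸ Th_mono_set hs) (fun h' => absurd h' h.not_gt)
        have k2 := key_ineq hc hpos han0 hν hn' le_rfl (hz _) (fun h' => absurd h' h.not_gt)
        linarith
  · obtain ⟨g1, g2, g3⟩ := G.seg hc hpos hs0.1 hsa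
    obtain ⟨f1, f2, f3⟩ := G.seg hc hpos hs0.2 hsb
    rw [← hnd] at g1 g2 g3 f1 f2 f3
    rw [uIoo_comm] at f2
    have q1 : Th m n (uIoo (T 0) R) = Th m n (uIoo (T 0) (T s0)) := Th_eq_of hpos hr0 hrm
    have q2 : Th m n (uIoo (T b) R) = Th m n (uIoo (T b) (T s0)) := Th_eq_of hpos hrb hrm
    have q3 : GG m n (T s0) = GG m n R := GG_eq_of hpos hc hrm
    -- orientation
    rw [uIoo_comm] at f2
    have f2' : Th m n (uIoo (T b) R) = ENNReal.ofReal |θ b - θ s0| := by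
      rw [q2, ← f2, uIoo_comm]
    have g2' : Th m n (uIoo (T 0) R) = ENNReal.ofReal |θ s0 - θ 0| := by
      rw [q1, ← g2]
    have k1 := key_ineq hc hpos han0 hν hn' (abs_nonneg _) g2'.ge (fun _ => g2')
    have k2 := key_ineq hc hpos hanb hν hn' (abs_nonneg _) f2'.ge (fun _ => f2')
    rw [q3] at g1 f1
    have hΔ : |θ b - θ 0| = |θ b - θ s0| + |θ s0 - θ 0| := by
      have h1 : n * (|θ b - θ s0| + |θ s0 - θ 0|) = ν * (θ b - θ 0) := by linarith
      have h2 : |ν * (θ b - θ 0)| = n * |θ b - θ 0| := by rw [abs_mul]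
      have h3 : 0 ≤ n * (|θ b - θ s0| + |θ s0 - θ 0|) :=
        mul_nonneg hn0.le (add_nonneg (abs_nonneg _) (abs_nonneg _))
      rw [← h1, abs_of_nonneg h3] at h2
      exact mul_left_cancel₀ hn0.ne' h2.symm
    rw [hΔ] at hL
    rw [abs_sub_comm (GG m n R)] at g1
    linarith

end CutAux

namespace CutAux
open MeasureTheory

/-- The standing assumptions on the warping function. -/
structure Warp (m : ℝ → ℝ) : Prop where
  sm : ContDiff ℝ (⊤:ℕ∞) m
  pos : ∀ t, 0 < m t
  ev : ∀ t, m (-t) = m t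
  dec : AntitoneOn (gaussK m) (Ici 0)

namespace Warp
variable {m : ℝ → ℝ}

lemma cont (W : Warp m) : Continuous m := W.sm.continuous

lemma diff (W : Warp m) : Differentiable ℝ m := W.sm.differentiable (by simp)

lemma sm' (W : Warp m) : ContDiff ℝ (⊤:ℕ∞) (deriv m) := ContDiff.deriv' W.sm

lemma cont' (W : Warp m) : Continuous (deriv m) := W.sm'.continuous

lemma hd (W : Warp m) (t : ℝ) : HasDerivAt m (deriv m t) t := (W.diff t).hasDerivAt

lemma hd' (W : Warp m) (t : ℝ) : HasDerivAt (deriv m) (-(gaussK m t * m t)) t := by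
  have h := (W.sm'.differentiable (by simp) t).hasDerivAt
  convert! h using 1
  have := (W.pos t).ne'
  unfold gaussK; field_simp

lemma odd (W : Warp m) (t : ℝ) : deriv m (-t) = - deriv m t := by
  have h := deriv_comp_neg (f := m) (x := t)
  have : (fun x => m (-x)) = m := funext W.ev
  rw [this] at h; linarith

lemma zero (W : Warp m) : deriv m 0 = 0 := by
  have := W.odd 0; simp at this; linarith

lemma abs (W : Warp m) (t : ℝ) : m |t| = m t := by
  rcases abs_choice t with h | h <;> rw [h]; exact W.ev t

lemma signK (W : Warp m) {t : ℝ} (ht : 0 < t) (h : 0 ≤ deriv m t) : gaussK m t ≤ 0 := by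
  by_contra hk
  push Not at hk
  have : StrictAntiOn (deriv m) (Icc 0 t) := by
    apply strictAntiOn_of_deriv_neg (convex_Icc 0 t) W.cont'.continuousOn
    intro s hs
    rw [interior_Icc] at hs
    rw [(W.hd' s).deriv]
    have h1 := W.dec (show s ∈ Ici 0 from hs.1.le) (show t ∈ Ici 0 from ht.le) hs.2.le
    have := W.pos s
    have : 0 < gaussK m s * m s := mul_pos (by linarith) this
    linarith
  have := this (left_mem_Icc.2 ht.le) (right_mem_Icc.2 ht.le) ht
  rw [W.zero] at this
  linarith

lemma mono' (W : Warp m) {t : ℝ} (ht : 0 < t) (h : 0 ≤ deriv m t) :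
    MonotoneOn (deriv m) (Ici t) := by
  apply monotoneOn_of_deriv_nonneg (convex_Ici t) W.cont'.continuousOn
    (fun s _ => (W.hd' s).differentiableAt.differentiableWithinAt)
  intro s hs
  rw [interior_Ici] at hs
  rw [(W.hd' s).deriv]
  have h1 := W.dec (show t ∈ Ici 0 from ht.le) (show s ∈ Ici 0 from ht.le.trans hs.le) (le_of_lt hs)
  have h2 := W.signK ht h
  have := W.pos s
  nlinarith

lemma nonneg' (W : Warp m) {t s : ℝ} (ht : 0 < t) (h : 0 ≤ deriv m t) (hs : t ≤ s) :
    deriv m t ≤ deriv m s := W.mono' ht h self_mem_Ici hs hs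

lemma antiOn (W : Warp m) {R : ℝ} (h : ∀ t ∈ Ioo 0 R, deriv m t ≤ 0) : AntitoneOn m (Icc 0 R) := by
  apply antitoneOn_of_deriv_nonpos (convex_Icc 0 R) W.cont.continuousOn W.diff.differentiableOn
  intro s hs; rw [interior_Icc] at hs; exact h s hs

lemma monoOn (W : Warp m) {R : ℝ} (h : ∀ t, R < t → 0 ≤ deriv m t) : MonotoneOn m (Ici R) := by
  apply monotoneOn_of_deriv_nonneg (convex_Ici R) W.cont.continuousOn W.diff.differentiableOn
  intro s hs; rw [interior_Ici] at hs; exact h s hs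

lemma rstar (W : Warp m) {S : ℝ} (hS : 0 ≤ S) : ∃ R, 0 ≤ R ∧ R ≤ S ∧
    (∀ t ∈ Ioo 0 R, deriv m t < 0) ∧ (R < S → ∀ t, R < t → 0 ≤ deriv m t) := by
  set Q : Set ℝ := {t | 0 ≤ t ∧ ((0 < t ∧ 0 ≤ deriv m t) ∨ S ≤ t)}
  have hbd : BddBelow Q := ⟨0, fun t ht => ht.1⟩
  have hSQ : S ∈ Q := ⟨hS, Or.inr le_rfl⟩
  refine ⟨sInf Q, le_csInf ⟨S, hSQ⟩ fun t ht => ht.1, csInf_le hbd hSQ, ?_, ?_⟩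
  · intro t ht
    by_contra h
    exact (notMem_of_lt_csInf ht.2 hbd) ⟨ht.1.le, Or.inl ⟨ht.1, not_lt.1 h⟩⟩
  · intro h t ht
    obtain ⟨q, hq, hqt⟩ := exists_lt_of_csInf_lt ⟨S, hSQ⟩ (lt_min ht h)
    rcases hq.2 with h1 | h1
    · exact h1.2.trans (W.nonneg' h1.1 h1.2 (hqt.trans_le (min_le_left _ _)).le)
    · exact absurd (hqt.trans_le (min_le_right _ _)) h1.not_gt

lemma rstarB (W : Warp m) {t₁ : ℝ} (h0 : 0 < t₁) (h1 : 0 < deriv m t₁) : ∃ R, 0 ≤ R ∧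
    (∀ t, 0 < t → 0 < deriv m t → R ≤ t) ∧
    (∀ t ∈ Ioo 0 R, deriv m t ≤ 0) ∧ (∀ t, R < t → 0 < deriv m t) := by
  set Q : Set ℝ := {t | 0 < t ∧ 0 < deriv m t}
  have hbd : BddBelow Q := ⟨0, fun t ht => ht.1.le⟩
  have hSQ : t₁ ∈ Q := ⟨h0, h1⟩
  refine ⟨sInf Q, le_csInf ⟨_, hSQ⟩ fun t ht => ht.1.le, fun t ha hb => csInf_le hbd ⟨ha, hb⟩,
    ?_, ?_⟩
  · intro t ht
    by_contra h
    exact (notMem_of_lt_csInf ht.2 hbd) ⟨ht.1, not_le.1 h⟩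
  · intro t ht
    obtain ⟨q, hq, hqt⟩ := exists_lt_of_csInf_lt ⟨_, hSQ⟩ ht
    exact hq.2.trans_le (W.nonneg' hq.1 hq.2.le hqt.le)

lemma energy (W : Warp m) {R t : ℝ} (h : ∀ t ∈ Ioo 0 R, deriv m t < 0) (ht : t ∈ Ioo 0 R) :
    gaussK m t * (m 0 ^ 2 - m t ^ 2) ≤ deriv m t ^ 2 := by
  have hdd : ∀ s, HasDerivAt (fun s => deriv m s ^ 2 + gaussK m t * m s ^ 2)
      (2 * (m s * deriv m s * (gaussK m t - gaussK m s))) s := by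
    intro s
    have := ((W.hd' s).pow 2).add (((W.hd s).pow 2).const_mul (gaussK m t))
    convert! this using 1
    push_cast
    ring
  have : MonotoneOn (fun s => deriv m s ^ 2 + gaussK m t * m s ^ 2) (Icc 0 t) := by
    apply monotoneOn_of_deriv_nonneg (convex_Icc 0 t)
      (fun s _ => (hdd s).continuousAt.continuousWithinAt)
      (fun s _ => (hdd s).differentiableAt.differentiableWithinAt)
    intro s hs
    rw [interior_Icc] at hs
    rw [(hdd s).deriv]
    have h1 := W.dec (show s ∈ Ici 0 from hs.1.le) (show t ∈ Ici 0 from ht.1.le) hs.2.le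
    have h2 := W.pos s
    have h3 := h s ⟨hs.1, hs.2.trans ht.2⟩
    have h4 : 0 ≤ m s * (-deriv m s) * (gaussK m s - gaussK m t) :=
      mul_nonneg (mul_nonneg h2.le (by linarith)) (by linarith)
    linarith
  have := this (left_mem_Icc.2 ht.1.le) (right_mem_Icc.2 ht.1.le) ht.1.le
  simp only [W.zero] at this
  linarith

lemma betaMono (W : Warp m) {R : ℝ} (h : ∀ t ∈ Ioo 0 R, deriv m t < 0) :
    MonotoneOn (fun t => (m 0 ^ 2 - m t ^ 2) / deriv m t ^ 2) (Ioo 0 R) := by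
  have hdd : ∀ s ∈ Ioo 0 R, HasDerivAt (fun t => (m 0 ^ 2 - m t ^ 2) / deriv m t ^ 2)
      (2 * m s * (- deriv m s) * (deriv m s ^ 2 - gaussK m s * (m 0 ^ 2 - m s ^ 2)) /
        (deriv m s ^ 2) ^ 2) s := by
    intro s hs
    have := (((W.hd s).pow 2).const_sub (m 0 ^ 2)).div ((W.hd' s).pow 2)
      (pow_ne_zero 2 (h s hs).ne)
    convert! this using 1
    simp only [Pi.pow_apply]
    push_cast
    ring
  apply monotoneOn_of_deriv_nonneg (convex_Ioo 0 R)
    (fun s hs => (hdd s hs).continuousAt.continuousWithinAt)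
    (fun s hs => (hdd s (interior_subset hs)).differentiableAt.differentiableWithinAt)
  intro s hs
  have hs := interior_subset hs
  rw [(hdd s hs).deriv]
  have h1 := W.energy h hs
  have h2 := W.pos s
  have h3 := h s hs
  apply div_nonneg _ (by positivity)
  exact mul_nonneg (mul_nonneg (by positivity) (by linarith)) (by linarith)

lemma thA (W : Warp m) {R x : ℝ} (h : ∀ t ∈ Ioo 0 R, deriv m t < 0) (hx0 : 0 ≤ x) (hx : x ≤ R)
    (u u' : ℝ) (hu : m R ≤ u) (huu : u ≤ u') : Th m u' (uIoo x R) ≤ Th m u (uIoo x R) := by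
  have hsub : uIoo x R ⊆ Ioo 0 R := by
    rw [uIoo_of_le hx]; exact Ioo_subset_Ioo_left hx0
  have hsa : StrictAntiOn m (Icc 0 R) := by
    apply strictAntiOn_of_deriv_neg (convex_Icc 0 R) W.cont.continuousOn
    intro s hs; rw [interior_Icc] at hs; exact h s hs
  have hsub2 := hsub.trans Ioo_subset_Icc_self
  have hm0 := W.pos 0
  have h0R : (0:ℝ) ≤ R := hx0.trans hx
  have hlt : ∀ t ∈ uIoo x R, m t < m 0 := fun t ht =>
    hsa (left_mem_Icc.2 h0R) (hsub2 ht) (hsub ht).1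
  have hK : ∀ t ∈ uIoo x R, 0 < 1 - (m 0 ^ 2)⁻¹ * m t ^ 2 := by
    intro t ht
    have h1 := hlt t ht
    have h2 := W.pos t
    have : (m 0 ^ 2)⁻¹ * m t ^ 2 < 1 := by
      rw [inv_mul_lt_one₀ (by positivity)]; nlinarith
    linarith
  refine Th_anti W.cont W.diff W.pos (κ := (m 0 ^ 2)⁻¹) (hsa.injOn.mono hsub2)
    (fun t ht => (h t (hsub ht)).ne) hK ?_ ?_ hu huu
  · intro t ht t' ht' hle
    have hle' : t' ≤ t := (hsa.le_iff_ge (hsub2 ht) (hsub2 ht')).1 hle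
    have hb := W.betaMono h (hsub ht') (hsub ht) hle'
    have key : ∀ s ∈ uIoo x R, Real.sqrt (1 - (m 0 ^ 2)⁻¹ * m s ^ 2) / |deriv m s| =
        Real.sqrt ((m 0 ^ 2)⁻¹ * ((m 0 ^ 2 - m s ^ 2) / deriv m s ^ 2)) := by
      intro s hs
      rw [← Real.sqrt_sq_eq_abs, ← Real.sqrt_div (hK s hs).le]
      congr 1
      have := (h s (hsub hs)).ne
      field_simp
    rw [key t ht, key t' ht']
    apply Real.sqrt_le_sqrt
    exact mul_le_mul_of_nonneg_left hb (by positivity)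
  · intro t' ht' y hy1 hy2
    have ht'R : t' ≤ R := (hsub ht').2.le
    obtain ⟨t, ht, hty⟩ := intermediate_value_Ioo' ht'R W.cont.continuousOn ⟨hy1, hy2⟩
    refine ⟨t, ?_, hty⟩
    rw [uIoo_of_le hx] at ht' ⊢
    exact ⟨ht'.1.trans ht.1, ht.2⟩

lemma thB (W : Warp m) {R x : ℝ} (hR : 0 ≤ R) (h : ∀ t, R < t → 0 < deriv m t) (hx : R ≤ x)
    (u u' : ℝ) (hu : m R ≤ u) (huu : u ≤ u') : Th m u' (uIoo x R) ≤ Th m u (uIoo x R) := by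
  have hsub : uIoo x R ⊆ Ioi R := by
    rw [uIoo_of_ge hx]; exact Ioo_subset_Ioi_self
  have hsa : StrictMonoOn m (Ici R) := by
    apply strictMonoOn_of_deriv_pos (convex_Ici R) W.cont.continuousOn
    intro s hs; rw [interior_Ici] at hs; exact h s hs
  have hsub2 := hsub.trans Ioi_subset_Ici_self
  refine Th_anti W.cont W.diff W.pos (κ := 0) (hsa.injOn.mono hsub2)
    (fun t ht => (h t (hsub ht)).ne') (by simp) ?_ ?_ hu huu
  · intro t ht t' ht' hle
    have hle' : t ≤ t' := (hsa.le_iff_le (hsub2 ht) (hsub2 ht')).1 hle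
    have h1 := h t (hsub ht)
    have h2 := W.nonneg' (hR.trans_lt (hsub ht)) h1.le hle'
    rw [abs_of_pos h1, abs_of_pos (h1.trans_le h2)]
    simp only [zero_mul, sub_zero, Real.sqrt_one]
    exact one_div_le_one_div_of_le h1 h2
  · intro t' ht' y hy1 hy2
    obtain ⟨t, ht, hty⟩ := intermediate_value_Ioo (le_of_lt (hsub ht')) W.cont.continuousOn ⟨hy1, hy2⟩
    refine ⟨t, ?_, hty⟩
    rw [uIoo_of_ge hx] at ht' ⊢
    exact ⟨ht.1, ht.2.trans ht'.2⟩

end Warp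
end CutAux

namespace CutAux
open MeasureTheory

lemma const_sign {f : ℝ → ℝ} (hf : Continuous f) {a b : ℝ} (h : ∀ s ∈ Icc a b, f s ≠ 0) :
    (∀ s ∈ Icc a b, 0 < f s) ∨ (∀ s ∈ Icc a b, f s < 0) := by
  by_contra hcon
  push Not at hcon
  obtain ⟨⟨s, hs, hs'⟩, ⟨r, hr, hr'⟩⟩ := hcon
  obtain ⟨q, hq, hq'⟩ := isPreconnected_Icc.intermediate_value hs hr hf.continuousOn ⟨hs', hr'⟩
  exact h q hq hq'

lemma Geo.contT {m T T' θ θ' : ℝ → ℝ} {ν : ℝ} (G : Geo m T T' θ θ' ν) : Continuous T :=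
  continuous_iff_continuousAt.2 fun s => (G.dT s).continuousAt

lemma Geo.contT' {m T T' θ θ' : ℝ → ℝ} {ν : ℝ} (G : Geo m T T' θ θ' ν) : Continuous T' :=
  continuous_iff_continuousAt.2 fun s => (G.dT' s).continuousAt

lemma lower_trivial {m T T' θ θ' : ℝ → ℝ} {ν : ℝ} (W : Warp m) (G : Geo m T T' θ θ' ν)
    {b : ℝ} (hb : 0 ≤ b) (hmin : ∀ x, |ν| ≤ m x)
    {c : ℝ → ℝ × ℝ} (hcd : ContDiff ℝ 1 c) {B : ℝ} (hB : 0 ≤ B)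
    (e0 : |(c 0).1| = T 0) (eb : |(c B).1| = T b) (eth : (c B).2 - (c 0).2 = θ b - θ 0) :
    b ≤ wLength m c 0 B := by
  have hL := curve_lb W.cont W.pos W.ev hcd (n := |ν|) (abs_nonneg _) (left_mem_Icc.2 hB)
    (fun s _ => hmin _)
  rw [e0, eb, eth] at hL
  simp only [sub_self, abs_zero] at hL
  by_cases hz : ∃ s ∈ Icc 0 b, T' s = 0
  · obtain ⟨s0, hs0, hT⟩ := hz
    have h1 := G.turn W.pos hT
    have hmn : IsLocalMin m (T s0) := Filter.Eventually.of_forall fun x => by rw [h1]; exact hmin x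
    have hcst := geo_const W.sm W.pos G hT hmn.deriv_eq_zero
    have hmT : ∀ s, m (T s) = |ν| := fun s => by rw [hcst s, h1]
    have hν : 0 < |ν| := h1 ▸ W.pos _
    have hth : ∀ s, θ' s = ν / |ν| ^ 2 := fun s => by rw [G.th' W.pos, hmT]
    have hcon : ∀ s, HasDerivAt (fun s => θ s - ν / |ν| ^ 2 * s) 0 s := by
      intro s
      have := (G.dth s).sub ((hasDerivAt_id s).const_mul (ν / |ν| ^ 2))
      convert! this using 1
      rw [hth]; ring
    have h2 := is_const_of_deriv_eq_zero (fun s => (hcon s).differentiableAt)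
      (fun s => (hcon s).deriv) b 0
    have h3 : θ b - θ 0 = ν / |ν| ^ 2 * b := by linarith
    have h4 : |ν| * |θ b - θ 0| = b := by
      rw [h3, abs_mul, abs_div, abs_of_nonneg hb, abs_pow, abs_abs]
      field_simp
    have := abs_nonneg (GG m |ν| (T b) - GG m |ν| (T 0))
    linarith
  · push Not at hz
    have hs : (∀ s ∈ Ioo 0 b, 0 < T' s) ∨ (∀ s ∈ Ioo 0 b, T' s < 0) := by
      rcases const_sign G.contT' hz with h | h
      · exact Or.inl fun s hs => h s (Ioo_subset_Icc_self hs)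
      · exact Or.inr fun s hs => h s (Ioo_subset_Icc_self hs)
    have := (G.seg W.cont W.pos hb hs).1
    linarith

lemma lower {m T T' θ θ' : ℝ → ℝ} {ν : ℝ} (W : Warp m) (G : Geo m T T' θ θ' ν)
    {b : ℝ} (hb : 0 ≤ b) (hT0 : 0 ≤ T 0) (hTp : ∀ s ∈ Ioc 0 b, 0 < T s)
    {c : ℝ → ℝ × ℝ} (hcd : ContDiff ℝ 1 c) {B : ℝ} (hB : 0 ≤ B)
    (e0 : |(c 0).1| = T 0) (eb : |(c B).1| = T b) (eth : (c B).2 - (c 0).2 = θ b - θ 0) :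
    b ≤ wLength m c 0 B := by
  by_cases hmin : ∀ x, |ν| ≤ m x
  · exact lower_trivial W G hb hmin hcd hB e0 eb eth
  push Not at hmin
  obtain ⟨R', hR'⟩ := hmin
  obtain ⟨R, hR0, hR⟩ : ∃ R, 0 ≤ R ∧ m R < |ν| := ⟨|R'|, abs_nonneg _, by rw [W.abs]; exact hR'⟩
  have hν : ν ≠ 0 := by
    rintro rfl; simp at hR; exact absurd (W.pos R) hR.not_gt
  have hle := G.le W.pos
  have hTnn : ∀ s ∈ Icc 0 b, 0 ≤ T s := by
    intro s hs
    rcases hs.1.eq_or_lt with h | h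
    · rw [← h]; exact hT0
    · exact (hTp s ⟨h, hs.2⟩).le
  have h0m : (0:ℝ) ∈ Icc 0 b := left_mem_Icc.2 hb
  have hbm : b ∈ Icc 0 b := right_mem_Icc.2 hb
  have hth2 : ∀ s, 0 < θ' s ^ 2 := by
    intro s
    have : θ' s ≠ 0 := by
      intro h; apply hν; rw [← G.clair s, h, mul_zero]
    positivity
  have hcabs : ContinuousOn (fun s => |(c s).1|) (Icc 0 B) := by
    have := hcd.continuous; fun_prop
  have hside := const_sign (f := fun s => R - T s) (by have := G.contT; fun_prop) (a := 0) (b := b)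
    (fun s _ h => by
      have h1 : T s = R := by linarith
      have := hle s; rw [h1] at this; linarith)
  rcases hside with hA | hBB
  · -- Case A
    have hTR : ∀ s ∈ Icc 0 b, T s < R := fun s hs => by have := hA s hs; simp at this; exact this
    obtain ⟨s₁, hs₁, hmax⟩ := isCompact_Icc.exists_isMaxOn ⟨0, left_mem_Icc.2 hB⟩ hcabs
    have hmax : ∀ s ∈ Icc 0 B, |(c s).1| ≤ |(c s₁).1| := fun s hs => hmax hs
    set M := |(c s₁).1| with hM
    have hM0 : 0 ≤ M := abs_nonneg _
    obtain ⟨Q, hQ0, hQS, hQn, hQp⟩ := W.rstar (S := max R M) (hR0.trans (le_max_left _ _))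
    have hanti := W.antiOn (fun t ht => (hQn t ht).le)
    have hmono : Q < max R M → MonotoneOn m (Ici Q) := fun h => W.monoOn (hQp h)
    have hQR : m Q ≤ m R := by
      rcases le_or_gt R Q with h | h
      · exact hanti ⟨hR0, h⟩ ⟨hQ0, le_rfl⟩ h
      · exact hmono (lt_max_of_lt_left h) self_mem_Ici h.le h.le
    have hTQ : ∀ s ∈ Icc 0 b, T s < Q := by
      intro s hs
      by_contra h
      push Not at h
      have h1 := hTR s hs
      have h2 := hmono (lt_max_of_lt_left (h.trans_lt h1)) h (h.trans h1.le) h1.le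
      have := hle s
      linarith
    have hsanti : StrictAntiOn T' (Icc 0 b) := by
      apply strictAntiOn_of_deriv_neg (convex_Icc 0 b) G.contT'.continuousOn
      intro s hs
      rw [interior_Icc] at hs
      rw [(G.dT' s).deriv]
      have h1 := hQn (T s) ⟨hTp s ⟨hs.1, hs.2.le⟩, hTQ s (Ioo_subset_Icc_self hs)⟩
      exact mul_neg_of_neg_of_pos (mul_neg_of_pos_of_neg (W.pos _) h1) (hth2 s)
    have hx0 : T 0 ≤ M := e0 ▸ hmax 0 (left_mem_Icc.2 hB)
    have hxb : T b ≤ M := eb ▸ hmax B (right_mem_Icc.2 hB)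
    have hglob : ∀ y, 0 ≤ y → y ≤ max R M → m Q ≤ m y := by
      intro y hy0 hy
      rcases le_or_gt y Q with h | h
      · exact hanti ⟨hy0, h⟩ ⟨hQ0, le_rfl⟩ h
      · exact hmono (h.trans_le hy) self_mem_Ici h.le h.le
    have hGG : ∀ x, x ≤ M → x ≤ Q → |GG m (m (min M Q)) x - GG m (m (min M Q)) Q| ≤
        |GG m (m (min M Q)) x - GG m (m (min M Q)) M| := by
      intro x hxM hxQ
      rcases le_total M Q with h | h
      · rw [min_eq_left h]
        have : GG m (m M) M = GG m (m M) Q := by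
          apply GG_eq_of W.pos W.cont
          intro t ht
          rw [uIcc_of_le h] at ht
          exact hanti ⟨hM0, h⟩ ⟨hM0.trans ht.1, ht.2⟩ ht.1
        rw [this]
      · have g := GG_mono W.cont W.pos (m (min M Q))
        have g1 := g hxQ
        have g2 := g h
        rw [abs_sub_comm, abs_of_nonneg (by linarith), abs_sub_comm, abs_of_nonneg (by linarith)]
        linarith
    refine core W.cont W.pos W.ev G hb (R := Q) (hQR.trans hR.le)
      (W.thA hQn hT0 (hTQ 0 h0m).le) (W.thA hQn (hTnn b hbm) (hTQ b hbm).le)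
      (Or.inl ⟨(hTQ 0 h0m).le, (hTQ b hbm).le⟩) ?_ hcd hs₁ (n' := m (min M Q))
      (hglob _ (le_min hM0 hQ0) ((min_le_right _ _).trans hQS)) ?_
      (hGG _ hx0 (hTQ 0 h0m).le) (hGG _ hxb (hTQ b hbm).le) e0 eb eth
    · by_cases hz : ∃ s ∈ Icc 0 b, T' s = 0
      · right
        obtain ⟨s0, hs0, hz⟩ := hz
        have p1 : ∀ s ∈ Ioo 0 s0, 0 < T' s := fun s hs => by
          rw [← hz]; exact hsanti ⟨hs.1.le, hs.2.le.trans hs0.2⟩ hs0 hs.2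
        have p2 : ∀ s ∈ Ioo s0 b, T' s < 0 := fun s hs => by
          rw [← hz]; exact hsanti hs0 ⟨hs0.1.trans hs.1.le, hs.2.le⟩ hs.1
        have m1 : T 0 ≤ T s0 := by
          have : MonotoneOn T (Icc 0 s0) := by
            apply monotoneOn_of_deriv_nonneg (convex_Icc 0 s0) G.contT.continuousOn
              (fun s _ => (G.dT s).differentiableAt.differentiableWithinAt)
            intro s hs; rw [interior_Icc] at hs; rw [(G.dT s).deriv]; exact (p1 s hs).le
          exact this (left_mem_Icc.2 hs0.1) (right_mem_Icc.2 hs0.1) hs0.1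
        have m2 : T b ≤ T s0 := by
          have : AntitoneOn T (Icc s0 b) := by
            apply antitoneOn_of_deriv_nonpos (convex_Icc s0 b) G.contT.continuousOn
              (fun s _ => (G.dT s).differentiableAt.differentiableWithinAt)
            intro s hs; rw [interior_Icc] at hs; rw [(G.dT s).deriv]; exact (p2 s hs).le
          exact this (left_mem_Icc.2 hs0.2) (right_mem_Icc.2 hs0.2) hs0.2
        have m3 := hTQ s0 hs0
        refine ⟨s0, hs0, hz, Or.inl p1, Or.inr p2, mem_uIcc.2 (Or.inl ⟨m1, m3.le⟩),
          mem_uIcc.2 (Or.inl ⟨m2, m3.le⟩), ?_⟩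
        intro t ht
        rw [uIcc_of_le m3.le] at ht
        rw [← G.turn W.pos hz]
        have := hTnn s0 hs0
        exact hanti ⟨this, m3.le⟩ ⟨this.trans ht.1, ht.2⟩ ht.1
      · push Not at hz
        left
        rcases const_sign G.contT' hz with h | h
        · exact Or.inl fun s hs => h s (Ioo_subset_Icc_self hs)
        · exact Or.inr fun s hs => h s (Ioo_subset_Icc_self hs)
    · intro s hs
      rw [← W.abs (c s).1]
      have hy := hmax s hs
      have hy0 := abs_nonneg (c s).1
      rcases le_total M Q with h | h
      · rw [min_eq_left h]
        exact hanti ⟨hy0, hy.trans h⟩ ⟨hM0, h⟩ hy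
      · rw [min_eq_right h]
        exact hglob _ hy0 (hy.trans (le_max_right _ _))
  · -- Case B
    have hTR : ∀ s ∈ Icc 0 b, R < T s := fun s hs => by have := hBB s hs; simp at this; exact this
    obtain ⟨s₁, hs₁, hmin⟩ := isCompact_Icc.exists_isMinOn ⟨0, left_mem_Icc.2 hB⟩ hcabs
    have hmin : ∀ s ∈ Icc 0 B, |(c s₁).1| ≤ |(c s).1| := fun s hs => hmin hs
    set M := |(c s₁).1| with hM
    have hM0 : 0 ≤ M := abs_nonneg _
    have hmvt : ∀ s ∈ Icc 0 b, ∃ t, 0 < t ∧ 0 < deriv m t ∧ t < T s := by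
      intro s hs
      obtain ⟨t, ht, hdt⟩ := exists_deriv_eq_slope m (hTR s hs) W.cont.continuousOn
        W.diff.differentiableOn
      refine ⟨t, hR0.trans_lt ht.1, ?_, ht.2⟩
      rw [hdt]
      apply div_pos
      · have := hle s; linarith
      · have := hTR s hs; linarith
    obtain ⟨t₁, ht₁, ht₁', -⟩ := hmvt 0 h0m
    obtain ⟨Q, hQ0, hQi, hQn, hQp⟩ := W.rstarB ht₁ ht₁'
    have hanti := W.antiOn hQn
    have hmono := W.monoOn (fun t ht => (hQp t ht).le)
    have hglob : ∀ y, 0 ≤ y → m Q ≤ m y := by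
      intro y hy0
      rcases le_or_gt y Q with h | h
      · exact hanti ⟨hy0, h⟩ ⟨hQ0, le_rfl⟩ h
      · exact hmono self_mem_Ici h.le h.le
    have hQR : m Q ≤ m R := hglob R hR0
    have hTQ : ∀ s ∈ Icc 0 b, Q < T s := by
      intro s hs
      obtain ⟨t, h1, h2, h3⟩ := hmvt s hs
      exact (hQi t h1 h2).trans_lt h3
    have hsmono : StrictMonoOn T' (Icc 0 b) := by
      apply strictMonoOn_of_deriv_pos (convex_Icc 0 b) G.contT'.continuousOn
      intro s hs
      rw [interior_Icc] at hs
      rw [(G.dT' s).deriv]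
      have h1 := hQp (T s) (hTQ s (Ioo_subset_Icc_self hs))
      exact mul_pos (mul_pos (W.pos _) h1) (hth2 s)
    have hx0 : M ≤ T 0 := e0 ▸ hmin 0 (left_mem_Icc.2 hB)
    have hxb : M ≤ T b := eb ▸ hmin B (right_mem_Icc.2 hB)
    have hGG : ∀ x, M ≤ x → Q ≤ x → |GG m (m (max M Q)) x - GG m (m (max M Q)) Q| ≤
        |GG m (m (max M Q)) x - GG m (m (max M Q)) M| := by
      intro x hxM hxQ
      rcases le_total Q M with h | h
      · rw [max_eq_left h]
        have : GG m (m M) M = GG m (m M) Q := by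
          apply GG_eq_of W.pos W.cont
          intro t ht
          rw [uIcc_of_ge h] at ht
          exact hmono ht.1 h ht.2
        rw [this]
      · have g := GG_mono W.cont W.pos (m (max M Q))
        have g1 := g hxQ
        have g2 := g h
        rw [abs_of_nonneg (by linarith), abs_of_nonneg (by linarith)]
        linarith
    refine core W.cont W.pos W.ev G hb (R := Q) (hQR.trans hR.le)
      (W.thB hQ0 hQp (hTQ 0 h0m).le) (W.thB hQ0 hQp (hTQ b hbm).le)
      (Or.inr ⟨(hTQ 0 h0m).le, (hTQ b hbm).le⟩) ?_ hcd hs₁ (n' := m (max M Q))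
      (hglob _ (hM0.trans (le_max_left _ _))) ?_
      (hGG _ hx0 (hTQ 0 h0m).le) (hGG _ hxb (hTQ b hbm).le) e0 eb eth
    · by_cases hz : ∃ s ∈ Icc 0 b, T' s = 0
      · right
        obtain ⟨s0, hs0, hz⟩ := hz
        have p1 : ∀ s ∈ Ioo 0 s0, T' s < 0 := fun s hs => by
          rw [← hz]; exact hsmono ⟨hs.1.le, hs.2.le.trans hs0.2⟩ hs0 hs.2
        have p2 : ∀ s ∈ Ioo s0 b, 0 < T' s := fun s hs => by
          rw [← hz]; exact hsmono hs0 ⟨hs0.1.trans hs.1.le, hs.2.le⟩ hs.1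
        have m1 : T s0 ≤ T 0 := by
          have : AntitoneOn T (Icc 0 s0) := by
            apply antitoneOn_of_deriv_nonpos (convex_Icc 0 s0) G.contT.continuousOn
              (fun s _ => (G.dT s).differentiableAt.differentiableWithinAt)
            intro s hs; rw [interior_Icc] at hs; rw [(G.dT s).deriv]; exact (p1 s hs).le
          exact this (left_mem_Icc.2 hs0.1) (right_mem_Icc.2 hs0.1) hs0.1
        have m2 : T s0 ≤ T b := by
          have : MonotoneOn T (Icc s0 b) := by
            apply monotoneOn_of_deriv_nonneg (convex_Icc s0 b) G.contT.continuousOn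
              (fun s _ => (G.dT s).differentiableAt.differentiableWithinAt)
            intro s hs; rw [interior_Icc] at hs; rw [(G.dT s).deriv]; exact (p2 s hs).le
          exact this (left_mem_Icc.2 hs0.2) (right_mem_Icc.2 hs0.2) hs0.2
        have m3 := hTQ s0 hs0
        refine ⟨s0, hs0, hz, Or.inr p1, Or.inl p2, mem_uIcc.2 (Or.inr ⟨m3.le, m1⟩),
          mem_uIcc.2 (Or.inr ⟨m3.le, m2⟩), ?_⟩
        intro t ht
        rw [uIcc_of_ge m3.le] at ht
        rw [← G.turn W.pos hz]
        exact hmono ht.1 m3.le ht.2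
      · push Not at hz
        left
        rcases const_sign G.contT' hz with h | h
        · exact Or.inl fun s hs => h s (Ioo_subset_Icc_self hs)
        · exact Or.inr fun s hs => h s (Ioo_subset_Icc_self hs)
    · intro s hs
      rw [← W.abs (c s).1]
      have hy := hmin s hs
      rcases le_total Q M with h | h
      · rw [max_eq_left h]
        exact hmono h (h.trans hy) hy
      · rw [max_eq_right h]
        exact hglob _ (abs_nonneg _)

end CutAux

namespace CutAux
open MeasureTheory Filter Topology

lemma wDist_le {m : ℝ → ℝ} {c : ℝ → ℝ × ℝ} {b : ℝ} (hb : 0 ≤ b) (hc : ContDiff ℝ 1 c) :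
    wDist m (c 0) (c b) ≤ wLength m c 0 b := by
  apply csInf_le
  · refine ⟨0, ?_⟩
    rintro L ⟨c, b, hb, -, -, -, rfl⟩
    exact intervalIntegral.integral_nonneg hb (fun s _ => Real.sqrt_nonneg _)
  · exact ⟨c, b, hb, hc, rfl, rfl, rfl⟩

lemma wLength_geo {m : ℝ → ℝ} {γ : ℝ → ℝ × ℝ} (h : IsUnitGeodesic m γ) (b : ℝ) :
    wLength m γ 0 b = b := by
  unfold wLength
  simp only [h.2.2.2]
  simp

lemma geo_of {m : ℝ → ℝ} {γ : ℝ → ℝ × ℝ} (h : IsUnitGeodesic m γ) :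
    ∃ ν, Geo m (fun u => (γ u).1) (deriv fun u => (γ u).1) (fun u => (γ u).2)
      (deriv fun u => (γ u).2) ν := by
  obtain ⟨h1, h2, ⟨ν, h3⟩, h4⟩ := h
  have c1 : ContDiff ℝ 2 (fun u => (γ u).1) := contDiff_fst.comp h1
  have c2 : ContDiff ℝ 2 (fun u => (γ u).2) := contDiff_snd.comp h1
  refine ⟨ν, fun s => ((c1.differentiable (by norm_num)) s).hasDerivAt, fun s => ?_,
    fun s => ((c2.differentiable (by norm_num)) s).hasDerivAt, h3, h4⟩
  rw [← h2 s]
  have : ContDiff ℝ 1 (deriv fun u => (γ u).1) := by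
    have c1' : ContDiff ℝ (1 + 1) (fun u => (γ u).1) := by norm_num; exact c1
    exact ContDiff.deriv' c1'
  exact ((this.differentiable (by norm_num)) s).hasDerivAt

lemma Geo.neg {m T T' θ θ' : ℝ → ℝ} {ν : ℝ} (W : Warp m) (G : Geo m T T' θ θ' ν) :
    Geo m (fun s => - T s) (fun s => - T' s) θ θ' ν where
  dT s := (G.dT s).neg
  dT' s := by
    have := (G.dT' s).neg
    convert! this using 1
    rw [W.ev, W.odd]; ring
  dth := G.dth
  clair s := by rw [W.ev]; exact G.clair s
  unit s := by rw [W.ev, neg_sq]; exact G.unit s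

/-- Smoothed absolute value. -/
def rho (η x : ℝ) : ℝ := -x + ((max (x + η) 0) ^ 2 - (max (x - η) 0) ^ 2) / (2 * η)

/-- Derivative of `rho`. -/
def rho' (η x : ℝ) : ℝ := -1 + (max (x + η) 0 - max (x - η) 0) / η

lemma hasDeriv_maxsq (y : ℝ) : HasDerivAt (fun y : ℝ => (max y 0) ^ 2) (2 * max y 0) y := by
  rcases lt_trichotomy y 0 with h | h | h
  · rw [max_eq_right h.le, mul_zero]
    refine (hasDerivAt_const y (0:ℝ)).congr_of_eventuallyEq ?_
    filter_upwards [Iio_mem_nhds h] with z hz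
    rw [max_eq_right (le_of_lt hz)]; norm_num
  · subst h
    rw [← hasDerivWithinAt_univ, ← Iic_union_Ici (a := (0:ℝ))]
    apply HasDerivWithinAt.union
    · have := (hasDerivAt_const (0:ℝ) (0:ℝ)).hasDerivWithinAt (s := Iic 0)
      simp only [max_self, mul_zero]
      exact this.congr (fun z hz => by rw [max_eq_right hz]; norm_num) (by norm_num)
    · have := (hasDerivAt_pow 2 (0:ℝ)).hasDerivWithinAt (s := Ici 0)
      simp only [max_self, mul_zero]
      simp at this
      exact this.congr (fun z hz => by rw [max_eq_left hz]) (by norm_num)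
  · rw [max_eq_left h.le]
    have := hasDerivAt_pow 2 y
    simp only [Nat.cast_ofNat, Nat.add_one_sub_one, pow_one] at this
    refine this.congr_of_eventuallyEq ?_
    filter_upwards [Ioi_mem_nhds h] with z hz
    rw [max_eq_left (le_of_lt hz)]

lemma rho_deriv {η : ℝ} (hη : 0 < η) (x : ℝ) : HasDerivAt (rho η) (rho' η x) x := by
  have h1 : HasDerivAt (fun x => (max (x + η) 0) ^ 2) (2 * max (x + η) 0) x := by
    have := HasDerivAt.comp (h₂ := fun y : ℝ => (max y 0) ^ 2) (h := fun x => x + η) x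
      (hasDeriv_maxsq (x + η)) ((hasDerivAt_id x).add_const η)
    rw [mul_one] at this
    exact this
  have h2 : HasDerivAt (fun x => (max (x - η) 0) ^ 2) (2 * max (x - η) 0) x := by
    have := HasDerivAt.comp (h₂ := fun y : ℝ => (max y 0) ^ 2) (h := fun x => x - η) x
      (hasDeriv_maxsq (x - η)) ((hasDerivAt_id x).sub_const η)
    rw [mul_one] at this
    exact this
  have := (hasDerivAt_neg x).add ((h1.sub h2).div_const (2 * η))
  convert! this using 1
  unfold rho'
  field_simp

lemma rho_contDiff {η : ℝ} (hη : 0 < η) : ContDiff ℝ 1 (rho η) := by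
  rw [contDiff_one_iff_deriv]
  refine ⟨fun x => (rho_deriv hη x).differentiableAt, ?_⟩
  have : deriv (rho η) = rho' η := funext fun x => (rho_deriv hη x).deriv
  rw [this]
  unfold rho'
  fun_prop

lemma rho'_zero {η : ℝ} (hη : 0 < η) : rho' η 0 = 0 := by
  unfold rho'
  rw [max_eq_left (by linarith), max_eq_right (by linarith)]
  field_simp; ring

lemma rho'_sq {η : ℝ} (hη : 0 < η) (x : ℝ) : rho' η x ^ 2 ≤ 1 := by
  have h1 : 0 ≤ (max (x + η) 0 - max (x - η) 0) / η := by
    apply div_nonneg _ hη.le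
    have := max_le_max_right 0 (show x - η ≤ x + η by linarith)
    linarith
  have h2 : (max (x + η) 0 - max (x - η) 0) / η ≤ 2 := by
    rw [div_le_iff₀ hη]
    have h3 : max (x + η) 0 ≤ max (x - η) 0 + 2 * η := by
      apply max_le
      · have := le_max_left (x - η) 0; linarith
      · have := le_max_right (x - η) 0; linarith
    linarith
  unfold rho'
  nlinarith

lemma rho_eq {η x : ℝ} (hη : 0 < η) (h : η ≤ |x|) : rho η x = |x| := by
  unfold rho
  rcases le_abs.1 h with h | h
  · rw [max_eq_left (by linarith), max_eq_left (by linarith), abs_of_nonneg (by linarith)]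
    field_simp; ring
  · rw [max_eq_right (by linarith), max_eq_right (by linarith), abs_of_nonpos (by linarith)]
    simp

lemma rho_bd {η x : ℝ} (hη : 0 < η) (h : |x| < η) : |x| ≤ rho η x ∧ rho η x ≤ η := by
  obtain ⟨h1, h2⟩ := abs_lt.1 h
  unfold rho
  rw [max_eq_left (by linarith), max_eq_right (by linarith)]
  have : -x + ((x + η) ^ 2 - 0 ^ 2) / (2 * η) = (x ^ 2 + η ^ 2) / (2 * η) := by
    field_simp; ring
  rw [this, le_div_iff₀ (by positivity), div_le_iff₀ (by positivity)]
  constructor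
  · nlinarith [sq_nonneg (|x| - η), sq_abs x]
  · nlinarith [sq_abs x, abs_nonneg x]

lemma m_rho {m : ℝ → ℝ} (W : Warp m) {η : ℝ} (hη : 0 < η) (hanti : AntitoneOn m (Icc 0 η))
    (x : ℝ) : m (-rho η x) ≤ m x := by
  rw [W.ev, ← W.abs x]
  rcases le_or_gt η |x| with h | h
  · rw [rho_eq hη h]
  · obtain ⟨h1, h2⟩ := rho_bd hη h
    exact hanti ⟨abs_nonneg _, h.le⟩ ⟨(abs_nonneg _).trans h1, h2⟩ h1

lemma exists_eta {m : ℝ → ℝ} (W : Warp m) (hK0 : 0 < gaussK m 0) :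
    ∃ r > 0, ∀ η, η ≤ r → AntitoneOn m (Icc 0 η) := by
  have hc : Continuous (gaussK m) := by
    have h1 : Continuous (deriv (deriv m)) :=
      (ContDiff.deriv' (n := ((⊤:ℕ∞) : WithTop ℕ∞)) W.sm').continuous
    have h2 := W.cont
    have h3 : ∀ t, m t ≠ 0 := fun t => (W.pos t).ne'
    unfold gaussK
    fun_prop (disch := assumption)
  have h1 := hc.continuousAt.eventually (lt_mem_nhds hK0)
  obtain ⟨r, hr, h2⟩ := Metric.eventually_nhds_iff.1 h1
  refine ⟨r, hr, fun η hη => W.antiOn fun t ht => ?_⟩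
  by_contra h
  push Not at h
  have h3 := W.signK ht.1 h.le
  have h4 := h2 (y := t) (by rw [Real.dist_eq, sub_zero, abs_of_pos ht.1]; exact ht.2.trans_le hη)
  linarith

lemma step1 {m : ℝ → ℝ} (W : Warp m) (hK0 : 0 < gaussK m 0) {γ : ℝ → ℝ × ℝ}
    (hγ : IsUnitGeodesic m γ) {a : ℝ} (hp : (γ 0).1 ≤ 0) (ha0 : (γ a).1 < 0)
    (hmin : IsMinimalSeg m γ a) : ∀ s ∈ Ioc 0 a, (γ s).1 < 0 := by
  by_contra hcon
  push Not at hcon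
  obtain ⟨r, hr, hr0⟩ := hcon
  obtain ⟨ν, G⟩ := geo_of hγ
  have hγ1 : ContDiff ℝ 1 γ := hγ.1.of_le (by norm_num)
  obtain ⟨cd1, cd2⟩ := fst_hasDeriv hγ1
  set t : ℝ → ℝ := fun u => (γ u).1 with ht
  set t' := deriv t with ht'
  set θ : ℝ → ℝ := fun u => (γ u).2 with hθ
  have hp : t 0 ≤ 0 := hp
  have ha0 : t a < 0 := ha0
  have hr0 : 0 ≤ t r := hr0
  obtain ⟨s₁, hs₁, hz⟩ := intermediate_value_Icc' hr.2 G.contT.continuousOn ⟨ha0.le, hr0⟩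
  have hs0 : 0 < s₁ := hr.1.trans_le hs₁.1
  have hsa : s₁ < a := by
    rcases hs₁.2.eq_or_lt with h | h
    · rw [h] at hz; linarith
    · exact h
  have hd1 : t' s₁ ≠ 0 := by
    intro h
    have := geo_const W.sm W.pos G h (by rw [hz]; exact W.zero) a
    rw [hz] at this; linarith
  obtain ⟨δ, hδ, e, he, he0, heδ, hδ0⟩ : ∃ δ ∈ Ioo 0 s₁, ∃ e : ℝ, (e = 1 ∨ e = -1) ∧
      e * t 0 = t 0 ∧ e * t δ = -|t δ| ∧ t δ ≠ 0 := by
    rcases hp.eq_or_lt with h0 | h0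
    · have h1 : ∀ᶠ z in 𝓝[<] s₁, t z ≠ 0 :=
        ((G.dT s₁).eventually_ne hd1).filter_mono (nhdsWithin_mono _ (fun z hz => ne_of_lt hz))
      obtain ⟨δ, h2, h3⟩ := (h1.and (Ioo_mem_nhdsLT hs0)).exists
      rcases abs_choice (t δ) with h | h
      · exact ⟨δ, h3, -1, Or.inr rfl, by rw [h0]; simp, by rw [h]; ring, h2⟩
      · exact ⟨δ, h3, 1, Or.inl rfl, by ring, by rw [h]; ring, h2⟩
    · have h1 : ∀ᶠ z in 𝓝[>] (0:ℝ), t z < 0 :=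
        (G.contT.continuousAt.eventually (gt_mem_nhds h0)).filter_mono nhdsWithin_le_nhds
      obtain ⟨δ, h2, h3⟩ := (h1.and (Ioo_mem_nhdsGT hs0)).exists
      exact ⟨δ, h3, 1, Or.inl rfl, by ring, by rw [abs_of_neg h2]; ring, h2.ne⟩
  obtain ⟨r, hr, hanti⟩ := exists_eta W hK0
  obtain ⟨η, hη, hη1, hη2, hη3⟩ : ∃ η > 0, η < |t δ| ∧ η ≤ |t a| ∧ η ≤ r := by
    have h1 := abs_pos.2 hδ0
    have h2 := abs_pos.2 ha0.ne
    refine ⟨min (|t δ| / 2) (min |t a| r), lt_min (by linarith) (lt_min h2 hr), ?_, ?_, ?_⟩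
    · exact (min_le_left _ _).trans_lt (by linarith)
    · exact (min_le_right _ _).trans (min_le_left _ _)
    · exact (min_le_right _ _).trans (min_le_right _ _)
  have hanti := hanti η hη3
  have he2 : e ^ 2 = 1 := by rcases he with h | h <;> rw [h] <;> norm_num
  have hme : ∀ x, m (e * x) = m x := by
    intro x; rcases he with h | h <;> rw [h]
    · rw [one_mul]
    · rw [neg_one_mul, W.ev]
  set f : ℝ → ℝ := fun s => if s < δ then e * t s else -rho η (t s) with hf
  -- near `δ` both branches agree
  have hnear : ∀ᶠ s in 𝓝 δ, f s = e * t s := by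
    have h1 : e * t δ < -η := by rw [heδ]; linarith
    have h2 : ContinuousAt (fun s => e * t s) δ := (G.contT.const_mul e).continuousAt
    filter_upwards [h2.eventually (gt_mem_nhds h1)] with s hs
    simp only [hf]
    split_ifs with h
    · rfl
    · have h3 : |t s| = |e * t s| := by
        rw [abs_mul]
        have : |e| = 1 := by rcases he with h | h <;> rw [h] <;> norm_num
        rw [this, one_mul]
      have h4 : |e * t s| = -(e * t s) := abs_of_neg (by linarith)
      rw [rho_eq hη (by rw [h3, h4]; linarith), h3, h4]; ring
  have hloc : ∀ s, (f =ᶠ[𝓝 s] fun s => e * t s) ∨ (f =ᶠ[𝓝 s] fun s => -rho η (t s)) := by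
    intro s
    rcases lt_trichotomy s δ with h | h | h
    · left
      filter_upwards [Iio_mem_nhds h] with z hz
      exact if_pos hz
    · left; rw [h]; exact hnear
    · right
      filter_upwards [Ioi_mem_nhds h] with z hz
      exact if_neg (not_lt.2 (le_of_lt hz))
  have hfc : ContDiff ℝ 1 f := by
    rw [contDiff_iff_contDiffAt]
    intro s
    rcases hloc s with h | h
    · exact ContDiffAt.congr_of_eventuallyEq (contDiff_const.mul cd1).contDiffAt h
    · exact ContDiffAt.congr_of_eventuallyEq ((rho_contDiff hη).comp cd1).neg.contDiffAt h
  have hrd : ∀ s, HasDerivAt (fun s => -rho η (t s)) (-(rho' η (t s) * t' s)) s := by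
    intro s
    exact (HasDerivAt.comp (h₂ := rho η) (h := t) s (rho_deriv hη (t s)) (G.dT s)).neg
  have hsp : ∀ s, deriv f s ^ 2 + m (f s) ^ 2 * deriv θ s ^ 2 ≤ 1 := by
    intro s
    have hu := G.unit s
    rcases hloc s with h | h
    · rw [h.deriv_eq, h.eq_of_nhds, ((G.dT s).const_mul e).deriv]
      simp only [hme, mul_pow, he2, one_mul]
      exact hu.le
    · rw [h.deriv_eq, h.eq_of_nhds, (hrd s).deriv]
      have h1 := m_rho W hη hanti (t s)
      have h2 := W.pos (-rho η (t s))
      have h3 : m (-rho η (t s)) ^ 2 ≤ m (t s) ^ 2 := by gcongr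
      have h4 : (-(rho' η (t s) * t' s)) ^ 2 ≤ t' s ^ 2 := by
        rw [neg_sq, mul_pow]
        have := rho'_sq hη (t s)
        nlinarith [sq_nonneg (t' s)]
      have h5 := mul_le_mul_of_nonneg_right h3 (sq_nonneg (deriv θ s))
      linarith
  have hst : deriv f s₁ ^ 2 + m (f s₁) ^ 2 * deriv θ s₁ ^ 2 < 1 := by
    have hu := G.unit s₁
    have h : f =ᶠ[𝓝 s₁] fun s => -rho η (t s) := by
      filter_upwards [Ioi_mem_nhds hδ.2] with z hz
      exact if_neg (not_lt.2 (le_of_lt hz))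
    rw [h.deriv_eq, h.eq_of_nhds, (hrd s₁).deriv]
    have h1 := m_rho W hη hanti (t s₁)
    have h2 := W.pos (-rho η (t s₁))
    have h3 : m (-rho η (t s₁)) ^ 2 ≤ m (t s₁) ^ 2 := by gcongr
    have h4 : (-(rho' η (t s₁) * t' s₁)) ^ 2 < t' s₁ ^ 2 := by
      rw [hz, rho'_zero hη]
      have : 0 < t' s₁ ^ 2 := by positivity
      simpa using this
    have h5 := mul_le_mul_of_nonneg_right h3 (sq_nonneg (deriv θ s₁))
    linarith
  set c : ℝ → ℝ × ℝ := fun s => (f s, θ s) with hc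
  have hcc : ContDiff ℝ 1 c := hfc.prodMk cd2
  have c0 : c 0 = γ 0 := by
    have : f 0 = t 0 := by simp only [hf]; rw [if_pos hδ.1, he0]
    simp only [hc, this]; rfl
  have ca : c a = γ a := by
    have : f a = t a := by
      simp only [hf]
      rw [if_neg (not_lt.2 (hδ.2.trans hsa).le), rho_eq hη hη2, abs_of_neg ha0]; ring
    simp only [hc, this]; rfl
  have ha : 0 < a := hs0.trans hsa
  have hlt : wLength m c 0 a < ∫ s in (0:ℝ)..a, (1:ℝ) := by
    apply intervalIntegral.integral_lt_integral_of_continuousOn_of_le_of_exists_lt ha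
      (curve_cont W.cont hcc).continuousOn continuousOn_const
    · intro s _
      exact Real.sqrt_le_one.2 (hsp s)
    · refine ⟨s₁, ⟨hs0.le, hsa.le⟩, ?_⟩
      rw [Real.sqrt_lt' one_pos]
      simpa using hst
  have h1 := wDist_le (m := m) ha.le hcc
  rw [c0, ca, hmin] at h1
  simp at hlt
  linarith

lemma contra {m : ℝ → ℝ} (W : Warp m) (hK0 : 0 < gaussK m 0) {γ : ℝ → ℝ × ℝ}
    (hγ : IsUnitGeodesic m γ) {a : ℝ} (ha : 0 < a) (hp : (γ 0).1 ≤ 0) (ha0 : (γ a).1 < 0)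
    (hmin : IsMinimalSeg m γ a) : ∃ ε > 0, IsMinimalSeg m γ (a + ε) := by
  have h1 := step1 W hK0 hγ hp ha0 hmin
  obtain ⟨ν, G⟩ := geo_of hγ
  have hev : ∀ᶠ s in 𝓝 a, (γ s).1 < 0 := G.contT.continuousAt.eventually (gt_mem_nhds ha0)
  obtain ⟨r, hr, h2⟩ := Metric.eventually_nhds_iff.1 hev
  have hγ1 : ContDiff ℝ 1 γ := hγ.1.of_le (by norm_num)
  refine ⟨r / 2, by linarith, ?_⟩
  set b := a + r / 2 with hb
  have hb0 : 0 ≤ b := by linarith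
  have hneg : ∀ s ∈ Ioc 0 b, (γ s).1 < 0 := by
    intro s hs
    rcases le_or_gt s a with h | h
    · exact h1 s ⟨hs.1, h⟩
    · apply h2
      rw [Real.dist_eq, abs_of_pos (by linarith)]
      linarith [hs.2]
  apply le_antisymm
  · have := wDist_le (m := m) hb0 hγ1
    rwa [wLength_geo hγ] at this
  · apply le_csInf
    · exact ⟨_, γ, b, hb0, hγ1, rfl, rfl, rfl⟩
    · rintro L ⟨c, B, hB, hcd, c0, cB, rfl⟩
      refine lower W (G.neg W) hb0 ?_ ?_ hcd hB ?_ ?_ ?_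
      · linarith
      · intro s hs; have := hneg s hs; linarith
      · rw [c0, abs_of_nonpos hp]
      · rw [cB, abs_of_neg (hneg b ⟨by linarith, le_rfl⟩)]
      · rw [c0, cB]

end CutAux

/-- Lemma 4.1: if `t(p̃) ≤ 0` and the cut locus of `p̃` contains a point with
negative `t`-coordinate, then there are a cut point `y` of `p̃` and two distinct minimal
geodesic segments `α`, `β` from `p̃` to `y` bounding a sector `D(α,β)` which contains an
end point of the cut locus and lies in `{t < 0}`. -/
theorem stmt7 (m : ℝ → ℝ) (hm : ContDiff ℝ (⊤:ℕ∞) m) (hmpos : ∀ t, 0 < m t)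
    (hmeven : ∀ t, m (-t) = m t)
    (hK0 : 0 < gaussK m 0) (hKdec : AntitoneOn (gaussK m) (Ici 0))
    (p : ℝ × ℝ) (hp : p.1 ≤ 0)
    (hcut : ∃ x ∈ cutLocus m p, x.1 < 0) :
    ∃ y : ℝ × ℝ, IsCutPoint m p y ∧
      ∃ α β : ℝ → ℝ × ℝ, ∃ Lα Lβ : ℝ, 0 < Lα ∧ 0 < Lβ ∧
        IsUnitGeodesic m α ∧ IsUnitGeodesic m β ∧
        α 0 = p ∧ β 0 = p ∧ α Lα = y ∧ β Lβ = y ∧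
        IsMinimalSeg m α Lα ∧ IsMinimalSeg m β Lβ ∧
        α '' Set.Icc 0 Lα ≠ β '' Set.Icc 0 Lβ ∧
        ∃ D : Set (ℝ × ℝ), IsSectorOf α β Lα Lβ D ∧
          (∃ x ∈ D, IsEndPoint m p x) ∧ D ⊆ {z : ℝ × ℝ | z.1 < 0} := by
  exfalso
  obtain ⟨x, ⟨γ, a, hγ, h0, ha, hax, hmin, hno⟩, hx⟩ := hcut
  have W : CutAux.Warp m := ⟨hm, hmpos, hmeven, hKdec⟩
  obtain ⟨ε, hε, h⟩ := CutAux.contra W hK0 hγ ha (by rw [h0]; exact hp)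
    (by rw [hax]; exact hx) hmin
  exact hno ε hε h
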